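/- arXiv:2504.00612 — 3 statements merged into one kernel-verified Lean document; each statement's English description precedes it below -/
import Mathlib

section
/- The segment graph of a directed multigraph G (with a distinguished set of output vertices) can be obtained from G by a sequence of edge contractions of internal vertices; in particular, the segment graph of G is a minor of G. -/
/-- A finite directed multigraph with a distinguished set of output vertices. -/
structure MGraph where
  V : Type
  E : Type
  src : E → V
  tgt : E → V
  out : Set V

namespace MGraph

/-- An internal vertex: a non-output vertex of in-degree 1 and out-degree 1. -/
def Internal (G : MGraph) (v : G.V) : Prop :=
  v ∉ G.out ∧ (∃! e, G.tgt e = v) ∧ (∃! e, G.src e = v)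

def External (G : MGraph) (v : G.V) : Prop := ¬ G.Internal v

/-- A list of edges forms a directed walk. -/
def IsWalk (G : MGraph) : List G.E → Prop
  | [] => True
  | [_] => True
  | e₁ :: e₂ :: es => G.tgt e₁ = G.src e₂ ∧ G.IsWalk (e₂ :: es)

/-- The list of vertices visited by a walk. -/
def walkVerts (G : MGraph) : List G.E → List G.V
  | [] => []
  | e :: es => G.src e :: G.tgt e :: es.map G.tgt

/-- A one-way internal path: a nonempty simple directed path all of whose intermediate
vertices are internal (the first and last vertex may coincide). -/
def IsInternalPath (G : MGraph) (es : List G.E) : Prop :=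
  es ≠ [] ∧ G.IsWalk es ∧
  (∀ v ∈ (G.walkVerts es).tail.dropLast, G.Internal v) ∧
  (G.walkVerts es).tail.Nodup ∧ (G.walkVerts es).dropLast.Nodup

/-- A segment: a maximal one-way internal path. -/
def IsSegment (G : MGraph) (es : List G.E) : Prop :=
  G.IsInternalPath es ∧ (∀ e, ¬ G.IsInternalPath (e :: es)) ∧
  (∀ e, ¬ G.IsInternalPath (es ++ [e]))

def firstV (G : MGraph) (es : List G.E) : Option G.V := es.head?.map G.src

def lastV (G : MGraph) (es : List G.E) : Option G.V := es.getLast?.map G.tgt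

end MGraph

/-- The number of segments of a multigraph, counting segments as sets of edges. -/
noncomputable def segCount (G : MGraph) : ℕ :=
  {S : Set G.E | ∃ es, G.IsSegment es ∧ S = {e | e ∈ es}}.ncard
/-- Isomorphism of directed multigraphs. -/
def IsIso (G H : MGraph) : Prop :=
  ∃ (fV : G.V → H.V) (fE : G.E → H.E),
    Function.Bijective fV ∧ Function.Bijective fE ∧
    (∀ e, H.src (fE e) = fV (G.src e)) ∧ (∀ e, H.tgt (fE e) = fV (G.tgt e))

/-- `H` is obtained from `G` by deleting one edge. -/
def IsEdgeDeletion (G H : MGraph) : Prop :=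
  ∃ (e₀ : G.E) (f : G.V → H.V) (g : {e : G.E // e ≠ e₀} → H.E),
    Function.Bijective f ∧ Function.Bijective g ∧
    (∀ e, H.src (g e) = f (G.src e.1)) ∧ (∀ e, H.tgt (g e) = f (G.tgt e.1))

/-- `H` is obtained from `G` by deleting one vertex and all its incident edges. -/
def IsVertexDeletion (G H : MGraph) : Prop :=
  ∃ (v₀ : G.V) (f : {v : G.V // v ≠ v₀} → H.V)
    (g : {e : G.E // G.src e ≠ v₀ ∧ G.tgt e ≠ v₀} → H.E),
    Function.Bijective f ∧ Function.Bijective g ∧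
    (∀ e, H.src (g e) = f ⟨G.src e.1, e.2.1⟩) ∧ (∀ e, H.tgt (g e) = f ⟨G.tgt e.1, e.2.2⟩)

/-- `H` is obtained from `G` by contracting the edge `e₀`
(identifying its two endpoints and removing the edge). -/
def IsEdgeContractionAt (G H : MGraph) (e₀ : G.E) : Prop :=
  ∃ (f : G.V → H.V) (g : {e : G.E // e ≠ e₀} → H.E),
    Function.Surjective f ∧ Function.Bijective g ∧
    (∀ u v, f u = f v ↔
      (u = v ∨ (u = G.src e₀ ∧ v = G.tgt e₀) ∨ (u = G.tgt e₀ ∧ v = G.src e₀))) ∧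
    (∀ e, H.src (g e) = f (G.src e.1)) ∧ (∀ e, H.tgt (g e) = f (G.tgt e.1))

def IsEdgeContraction (G H : MGraph) : Prop := ∃ e₀, IsEdgeContractionAt G H e₀

def MinorStep (G H : MGraph) : Prop :=
  IsIso G H ∨ IsEdgeDeletion G H ∨ IsVertexDeletion G H ∨ IsEdgeContraction G H

/-- `H` is a minor of `G`: obtained by a sequence of edge deletions,
vertex deletions and edge contractions (up to isomorphism). -/
def IsMinorOf (H G : MGraph) : Prop := Relation.ReflTransGen MinorStep G H
/-- `H` is (a presentation of) the segment graph of `G`: its edges are in bijection with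
the segments of `G` (as edge sets), its endpoints are the external endpoints of the
corresponding segments via an injection `ι` of the external vertices of `G`, and each
isolated (all-internal) cycle yields a self-loop at a fresh vertex. -/
def IsSegmentGraph (G H : MGraph) : Prop :=
  ∃ (ι : {v : G.V // G.External v} → H.V) (β : H.E → List G.E),
    Function.Injective ι ∧
    (∀ e, G.IsSegment (β e)) ∧
    (∀ es, G.IsSegment es → ∃! e : H.E, ({x | x ∈ β e} : Set G.E) = {x | x ∈ es}) ∧
    (∀ (e : H.E) (v : G.V), G.firstV (β e) = some v → G.Internal v →
        ∀ x ∈ G.walkVerts (β e), G.Internal x) ∧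
    (∀ (e : H.E) (v : G.V) (hv : G.External v), G.firstV (β e) = some v → H.src e = ι ⟨v, hv⟩) ∧
    (∀ (e : H.E) (v : G.V) (hv : G.External v), G.lastV (β e) = some v → H.tgt e = ι ⟨v, hv⟩) ∧
    (∀ e : H.E, (∀ x ∈ G.walkVerts (β e), G.Internal x) →
        H.src e = H.tgt e ∧ H.src e ∉ Set.range ι) ∧
    (∀ e e' : H.E, H.src e ∉ Set.range ι → H.src e' ∉ Set.range ι →
        H.src e = H.src e' → ({x | x ∈ β e} : Set G.E) = {x | x ∈ β e'}) ∧
    (∀ v : H.V, v ∈ Set.range ι ∨ ∃ e : H.E, H.src e = v ∧ H.tgt e = v ∧ H.src e ∉ Set.range ι)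

/-- One contraction step of an internal variable: the edge `e₀` entering an internal
vertex is contracted (the resulting merged pair of edges carried implicitly),
preserving the output set. -/
def ContractInternalStep (G H : MGraph) : Prop :=
  ∃ (e₀ : G.E) (f : G.V → H.V) (g : {e : G.E // e ≠ e₀} → H.E),
    G.Internal (G.tgt e₀) ∧ G.src e₀ ≠ G.tgt e₀ ∧
    Function.Surjective f ∧ Function.Bijective g ∧
    (∀ u v, f u = f v ↔
      (u = v ∨ (u = G.src e₀ ∧ v = G.tgt e₀) ∨ (u = G.tgt e₀ ∧ v = G.src e₀))) ∧
    (∀ e, H.src (g e) = f (G.src e.1)) ∧ (∀ e, H.tgt (g e) = f (G.tgt e.1)) ∧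
    H.out = f '' G.out


/-- Two consecutive edges meeting in an internal vertex. -/
def EAdj (G : MGraph) (e e' : G.E) : Prop := G.tgt e = G.src e' ∧ G.Internal (G.tgt e)

/-- Invariant: `G` still contracts onto `H`. -/
structure SegInv (G H : MGraph) (ι : G.V → H.V) (ψ : G.E → H.E) : Prop where
  surj : Function.Surjective ψ
  adj : ∀ e e', EAdj G e e' → ψ e = ψ e'
  conn : ∀ e e', ψ e = ψ e' → Relation.EqvGen (EAdj G) e e'
  inj : ∀ u v, G.External u → G.External v → ι u = ι v → u = v
  src : ∀ e, G.External (G.src e) → H.src (ψ e) = ι (G.src e)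
  tgt : ∀ e, G.External (G.tgt e) → H.tgt (ψ e) = ι (G.tgt e)
  cyc : ∀ h, (∀ e, ψ e = h → G.Internal (G.src e) ∧ G.Internal (G.tgt e)) →
    H.src h = H.tgt h ∧ ∀ v, G.External v → ι v ≠ H.src h
  fresh : ∀ h h', (∀ v, G.External v → ι v ≠ H.src h) → (∀ v, G.External v → ι v ≠ H.src h') →
    H.src h = H.src h' → h = h'
  cover : ∀ w, (∃ v, G.External v ∧ ι v = w) ∨
    ∃ h, H.src h = w ∧ H.tgt h = w ∧ ∀ v, G.External v → ι v ≠ w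

theorem Internal_src_unique {G : MGraph} {v : G.V} (h : G.Internal v) {e e' : G.E}
    (h1 : G.src e = v) (h2 : G.src e' = v) : e = e' := h.2.2.unique h1 h2

theorem Internal_tgt_unique {G : MGraph} {v : G.V} (h : G.Internal v) {e e' : G.E}
    (h1 : G.tgt e = v) (h2 : G.tgt e' = v) : e = e' := h.2.1.unique h1 h2

theorem SegInv.terminal {G H : MGraph} {ι : G.V → H.V} {ψ : G.E → H.E} (I : SegInv G H ι ψ)
    (ht : ∀ e, G.Internal (G.tgt e) → G.src e = G.tgt e) : IsIso G H := by
  classical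
  have hψ : Function.Injective ψ := by
    intro e e' h
    have := I.conn e e' h
    induction this with
    | rel a b hab =>
      exact Internal_src_unique hab.2 (ht a hab.2) hab.1.symm
    | refl => rfl
    | symm a b _ ih => exact (ih h.symm).symm
    | trans a b c hab hbc ih1 ih2 =>
      have key : ∀ a b, Relation.EqvGen (EAdj G) a b → a = b := by
        intro a b hab
        induction hab with
        | rel a b hab => exact Internal_src_unique hab.2 (ht a hab.2) hab.1.symm
        | refl => rfl
        | symm a b _ ih => exact ih.symm
        | trans a b c _ _ h1 h2 => exact h1.trans h2
      exact (key _ _ hab).trans (key _ _ hbc)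
  have loop : ∀ e, G.Internal (G.src e) → G.tgt e = G.src e := by
    intro e he
    obtain ⟨e2, he2, -⟩ := he.2.1
    have h1 := ht e2 (by rw [he2]; exact he)
    have : e2 = e := Internal_src_unique he (h1.trans he2) rfl
    subst this; exact he2
  have hcyc : ∀ e, G.Internal (G.src e) →
      H.src (ψ e) = H.tgt (ψ e) ∧ ∀ v, G.External v → ι v ≠ H.src (ψ e) := by
    intro e he
    apply I.cyc
    intro e' he'
    rw [hψ he', loop e he]; exact ⟨he, he⟩
  let φ : G.V → H.V := fun v => if h : G.Internal v then H.src (ψ h.2.2.choose) else ι v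
  have φext : ∀ v, G.External v → φ v = ι v := fun v hv => dif_neg hv
  have φint : ∀ e, G.Internal (G.src e) → φ (G.src e) = H.src (ψ e) := by
    intro e he
    have h1 : φ (G.src e) = H.src (ψ he.2.2.choose) := dif_pos he
    rw [h1, Internal_src_unique he he.2.2.choose_spec.1 rfl]
  refine ⟨φ, ψ, ⟨?_, ?_⟩, ⟨hψ, I.surj⟩, ?_, ?_⟩
  · intro u v huv
    by_cases hu : G.Internal u <;> by_cases hv : G.Internal v
    · obtain ⟨e, rfl, -⟩ := hu.2.2
      obtain ⟨e', rfl, -⟩ := hv.2.2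
      rw [φint e hu, φint e' hv] at huv
      have := hψ (I.fresh _ _ (hcyc e hu).2 (hcyc e' hv).2 huv)
      rw [this]
    · obtain ⟨e, rfl, -⟩ := hu.2.2
      rw [φint e hu, φext v hv] at huv
      exact absurd huv.symm ((hcyc e hu).2 v hv)
    · obtain ⟨e, rfl, -⟩ := hv.2.2
      rw [φint e hv, φext u hu] at huv
      exact absurd huv ((hcyc e hv).2 u hu)
    · rw [φext u hu, φext v hv] at huv
      exact I.inj u v hu hv huv
  · intro w
    rcases I.cover w with ⟨v, hv, rfl⟩ | ⟨h, h1, h2, h3⟩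
    · exact ⟨v, φext v hv⟩
    · obtain ⟨e, rfl⟩ := I.surj h
      by_cases he : G.Internal (G.src e)
      · exact ⟨G.src e, (φint e he).trans h1⟩
      · exact absurd ((I.src e he).symm.trans h1) (h3 _ he)
  · intro e
    by_cases he : G.Internal (G.src e)
    · exact (φint e he).symm
    · rw [φext _ he]; exact I.src e he
  · intro e
    by_cases he : G.Internal (G.tgt e)
    · have h1 := ht e he
      rw [← h1] at he ⊢
      rw [φint e he]; exact (hcyc e he).1.symm
    · rw [φext _ he]; exact I.tgt e he

open Classical in
/-- The concrete contraction of an edge `e₀` with distinct endpoints. -/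
noncomputable def ctr (G : MGraph) (e₀ : G.E) (hne : G.src e₀ ≠ G.tgt e₀)
    (hi : G.Internal (G.tgt e₀)) : MGraph where
  V := {v : G.V // v ≠ G.tgt e₀}
  E := {e : G.E // e ≠ e₀}
  src e := if h : G.src e.1 = G.tgt e₀ then ⟨G.src e₀, hne⟩ else ⟨G.src e.1, h⟩
  tgt e := ⟨G.tgt e.1, fun h => e.2 (hi.2.1.unique h rfl)⟩
  out := {v | v.1 ∈ G.out}

section
variable {G : MGraph} {e₀ : G.E} {hne : G.src e₀ ≠ G.tgt e₀} {hi : G.Internal (G.tgt e₀)}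

theorem ctr_src_pos (e : (ctr G e₀ hne hi).E) (h : G.src e.1 = G.tgt e₀) :
    ((ctr G e₀ hne hi).src e).1 = G.src e₀ := by
  simp [ctr, h]

theorem ctr_src_neg (e : (ctr G e₀ hne hi).E) (h : G.src e.1 ≠ G.tgt e₀) :
    ((ctr G e₀ hne hi).src e).1 = G.src e.1 := by
  simp [ctr, h]

theorem ctr_tgt (e : (ctr G e₀ hne hi).E) :
    ((ctr G e₀ hne hi).tgt e).1 = G.tgt e.1 := rfl

theorem ctr_internal (v : (ctr G e₀ hne hi).V) :
    (ctr G e₀ hne hi).Internal v ↔ G.Internal v.1 := by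
  obtain ⟨e₁, he₁, hu₁⟩ := hi.2.2
  have hu₁ : ∀ e, G.src e = G.tgt e₀ → e = e₁ := hu₁
  have h10 : e₁ ≠ e₀ := by rintro rfl; exact hne he₁
  have hout : v ∈ (ctr G e₀ hne hi).out ↔ v.1 ∈ G.out := Iff.rfl
  have hT : (∃! e, (ctr G e₀ hne hi).tgt e = v) ↔ ∃! e, G.tgt e = v.1 := by
    constructor
    · rintro ⟨e, he, hu⟩
      refine ⟨e.1, congrArg Subtype.val he, fun e' he' => ?_⟩
      have h' : e' ≠ e₀ := by rintro rfl; exact v.2 he'.symm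
      exact congrArg Subtype.val (hu ⟨e', h'⟩ (Subtype.ext he'))
    · rintro ⟨e, he, hu⟩
      have h' : e ≠ e₀ := by rintro rfl; exact v.2 he.symm
      refine ⟨⟨e, h'⟩, Subtype.ext he, fun e' he' => ?_⟩
      exact Subtype.ext (hu e'.1 (congrArg Subtype.val he'))
  have hS : (∃! e, (ctr G e₀ hne hi).src e = v) ↔ ∃! e, G.src e = v.1 := by
    constructor
    · rintro ⟨e, he, hu⟩
      have hu : ∀ e', ((ctr G e₀ hne hi).src e').1 = v.1 → e' = e :=
        fun e' h => hu e' (Subtype.ext h)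
      replace he := congrArg Subtype.val he
      by_cases h : G.src e.1 = G.tgt e₀
      · rw [ctr_src_pos e h] at he
        refine ⟨e₀, he, fun e' he' => ?_⟩
        by_contra h'
        have hn : G.src e' ≠ G.tgt e₀ := fun h => v.2 (he'.symm.trans h)
        have := hu ⟨e', h'⟩ ((ctr_src_neg _ hn).trans he')
        exact hn (by rw [← this] at h; exact h)
      · rw [ctr_src_neg e h] at he
        refine ⟨e.1, he, fun e' he' => ?_⟩
        have hn : G.src e' ≠ G.tgt e₀ := fun h => v.2 (he'.symm.trans h)
        by_cases h' : e' = e₀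
        · subst h'
          have := hu ⟨e₁, h10⟩ ((ctr_src_pos _ he₁).trans he')
          rw [← this] at h; exact absurd he₁ h
        · exact congrArg Subtype.val (hu ⟨e', h'⟩ ((ctr_src_neg _ hn).trans he'))
    · rintro ⟨e, he, hu⟩
      by_cases h : e = e₀
      · subst h
        refine ⟨⟨e₁, h10⟩, Subtype.ext ((ctr_src_pos _ he₁).trans he), fun e' he' => ?_⟩
        replace he' := congrArg Subtype.val he'
        by_cases h' : G.src e'.1 = G.tgt e
        · exact Subtype.ext (hu₁ _ h')
        · rw [ctr_src_neg _ h'] at he'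
          exact absurd (hu _ he') e'.2
      · have hn : G.src e ≠ G.tgt e₀ := fun h => v.2 (he.symm.trans h)
        refine ⟨⟨e, h⟩, Subtype.ext ((ctr_src_neg _ hn).trans he), fun e' he' => ?_⟩
        replace he' := congrArg Subtype.val he'
        by_cases h' : G.src e'.1 = G.tgt e₀
        · rw [ctr_src_pos _ h'] at he'
          exact absurd (hu _ he').symm h
        · rw [ctr_src_neg _ h'] at he'
          exact Subtype.ext (hu _ he')
  unfold MGraph.Internal
  rw [hout, hT, hS]

theorem ctr_step (G : MGraph) (e₀ : G.E) (hne : G.src e₀ ≠ G.tgt e₀)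
    (hi : G.Internal (G.tgt e₀)) : ContractInternalStep G (ctr G e₀ hne hi) := by
  classical
  let f : G.V → (ctr G e₀ hne hi).V :=
    fun v => if h : v = G.tgt e₀ then ⟨G.src e₀, hne⟩ else ⟨v, h⟩
  have fpos : f (G.tgt e₀) = ⟨G.src e₀, hne⟩ := dif_pos rfl
  have fneg : ∀ v (h : v ≠ G.tgt e₀), f v = ⟨v, h⟩ := fun v h => dif_neg h
  refine ⟨e₀, f, id, hi, hne, ?_, Function.bijective_id, ?_, fun e => rfl, ?_, ?_⟩
  · intro v; exact ⟨v.1, fneg v.1 v.2⟩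
  · intro u v
    by_cases hu : u = G.tgt e₀ <;> by_cases hv : v = G.tgt e₀
    · simp [hu, hv]
    · subst hu
      rw [fpos, fneg v hv]
      constructor
      · intro h; right; right; exact ⟨rfl, (congrArg Subtype.val h).symm⟩
      · rintro (h | ⟨h, -⟩ | ⟨-, h⟩)
        · exact absurd h.symm hv
        · exact absurd h.symm hne
        · exact Subtype.ext h.symm
    · subst hv
      rw [fpos, fneg u hu]
      constructor
      · intro h; right; left; exact ⟨(congrArg Subtype.val h), rfl⟩
      · rintro (h | ⟨h, -⟩ | ⟨h, -⟩)
        · exact absurd h hu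
        · exact Subtype.ext h
        · exact absurd h hu
    · rw [fneg u hu, fneg v hv]
      constructor
      · intro h; left; exact congrArg Subtype.val h
      · rintro (h | ⟨-, h⟩ | ⟨h, -⟩)
        · exact Subtype.ext h
        · exact absurd h hv
        · exact absurd h hu
  · intro e
    exact (fneg (G.tgt e.1) (fun h => e.2 (hi.2.1.unique h rfl))).symm
  · ext v
    constructor
    · intro hv; exact ⟨v.1, hv, fneg v.1 v.2⟩
    · rintro ⟨u, hu, rfl⟩
      have : u ≠ G.tgt e₀ := by rintro rfl; exact hi.1 hu
      rw [fneg u this]; exact hu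

theorem SegInv.ctr {H : MGraph} {ι : G.V → H.V} {ψ : G.E → H.E} (I : SegInv G H ι ψ) :
    SegInv (ctr G e₀ hne hi) H (fun v => ι v.1) (fun e => ψ e.1) := by
  classical
  obtain ⟨e₁, he₁, hu₁⟩ := hi.2.2
  have hu₁ : ∀ e, G.src e = G.tgt e₀ → e = e₁ := hu₁
  have h10 : e₁ ≠ e₀ := by rintro rfl; exact hne he₁
  have hadj01 : EAdj G e₀ e₁ := ⟨he₁.symm, hi⟩
  have hψ01 := I.adj _ _ hadj01
  have hext : ∀ v : (_root_.ctr G e₀ hne hi).V,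
      (_root_.ctr G e₀ hne hi).External v ↔ G.External v.1 :=
    fun v => not_congr (ctr_internal v)
  have hextne : ∀ v, G.External v → v ≠ G.tgt e₀ := by rintro v hv rfl; exact hv hi
  have hextall : ∀ w, (∀ v, (_root_.ctr G e₀ hne hi).External v → ι v.1 ≠ w) ↔
      ∀ v, G.External v → ι v ≠ w := by
    intro w
    constructor
    · intro h v hv; exact h ⟨v, hextne v hv⟩ ((hext _).2 hv)
    · intro h v hv; exact h v.1 ((hext _).1 hv)
  refine ⟨?_, ?_, ?_, ?_, ?_, ?_, ?_, ?_, ?_⟩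
  · intro h
    obtain ⟨e, rfl⟩ := I.surj h
    by_cases he : e = e₀
    · exact ⟨⟨e₁, h10⟩, by rw [he]; exact hψ01.symm⟩
    · exact ⟨⟨e, he⟩, rfl⟩
  · rintro e e' ⟨h1, h2⟩
    rw [ctr_internal, ctr_tgt] at h2
    replace h1 := congrArg Subtype.val h1
    rw [ctr_tgt] at h1
    by_cases h : G.src e'.1 = G.tgt e₀
    · rw [ctr_src_pos _ h] at h1
      have h3 := I.adj e.1 e₀ ⟨h1, h2⟩
      show ψ e.1 = ψ e'.1
      rw [h3, hu₁ _ h]; exact hψ01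
    · rw [ctr_src_neg _ h] at h1
      exact I.adj _ _ ⟨h1, h2⟩
  · let r : G.E → (_root_.ctr G e₀ hne hi).E :=
      fun e => if h : e = e₀ then ⟨e₁, h10⟩ else ⟨e, h⟩
    have rpos : r e₀ = ⟨e₁, h10⟩ := dif_pos rfl
    have rneg : ∀ e (h : e ≠ e₀), r e = ⟨e, h⟩ := fun e h => dif_neg h
    have key : ∀ a b, Relation.EqvGen (EAdj G) a b →
        Relation.EqvGen (EAdj (_root_.ctr G e₀ hne hi)) (r a) (r b) := by
      intro a b hab
      induction hab with
      | rel a b hab =>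
        obtain ⟨h1, h2⟩ := hab
        by_cases ha : a = e₀
        · subst ha
          have := hu₁ b h1.symm
          subst this
          rw [rpos, rneg _ h10]; exact .refl _
        · have hav : G.tgt a ≠ G.tgt e₀ := fun h => ha (hi.2.1.unique h rfl)
          rw [rneg a ha]
          by_cases hb : b = e₀
          · subst hb
            rw [rpos]
            refine .rel _ _ ⟨Subtype.ext ?_, (ctr_internal _).2 h2⟩
            exact h1.trans (ctr_src_pos (hne := hne) (hi := hi) ⟨e₁, h10⟩ he₁).symm
          · rw [rneg b hb]
            refine .rel _ _ ⟨Subtype.ext ?_, (ctr_internal _).2 h2⟩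
            exact h1.trans (ctr_src_neg (hne := hne) (hi := hi) ⟨b, hb⟩
              (by rw [← h1]; exact hav)).symm
      | refl => exact .refl _
      | symm a b _ ih => exact .symm _ _ ih
      | trans a b c _ _ ih1 ih2 => exact .trans _ _ _ ih1 ih2
    intro e e' h
    have := key _ _ (I.conn e.1 e'.1 h)
    rwa [rneg _ e.2, rneg _ e'.2] at this
  · intro u v hu hv h
    exact Subtype.ext (I.inj _ _ ((hext _).1 hu) ((hext _).1 hv) h)
  · intro e he
    rw [hext] at he
    by_cases h : G.src e.1 = G.tgt e₀
    · rw [ctr_src_pos _ h] at he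
      show H.src (ψ e.1) = ι _
      rw [ctr_src_pos _ h, hu₁ _ h, ← hψ01]
      exact I.src _ he
    · rw [ctr_src_neg _ h] at he
      show H.src (ψ e.1) = ι _
      rw [ctr_src_neg _ h]
      exact I.src _ he
  · intro e he
    rw [hext] at he
    exact I.tgt _ he
  · intro h hh
    rw [hextall]
    apply I.cyc
    have hh' : ∀ e (he : e ≠ e₀), ψ e = h → G.Internal (G.src e) ∧ G.Internal (G.tgt e) := by
      intro e he heq
      obtain ⟨h1, h2⟩ := hh ⟨e, he⟩ heq
      rw [ctr_internal] at h1 h2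
      refine ⟨?_, h2⟩
      by_cases h' : G.src e = G.tgt e₀
      · rw [h']; exact hi
      · have h3 := ctr_src_neg (hne := hne) (hi := hi) ⟨e, he⟩ h'
        exact h3 ▸ h1
    intro e heq
    by_cases he : e = e₀
    · subst he
      refine ⟨?_, hi⟩
      obtain ⟨h1, -⟩ := hh ⟨e₁, h10⟩ (hψ01.symm.trans heq)
      rw [ctr_internal] at h1
      have h3 := ctr_src_pos (hne := hne) (hi := hi) ⟨e₁, h10⟩ he₁
      exact h3 ▸ h1
    · exact hh' e he heq
  · intro h h' h1 h2
    rw [hextall] at h1 h2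
    exact I.fresh _ _ h1 h2
  · intro w
    rcases I.cover w with ⟨v, hv, rfl⟩ | ⟨h, h1, h2, h3⟩
    · exact Or.inl ⟨⟨v, hextne v hv⟩, (hext _).2 hv, rfl⟩
    · exact Or.inr ⟨h, h1, h2, (hextall w).2 h3⟩

end

theorem SegInv.main (n : ℕ) : ∀ (G H : MGraph) (ι : G.V → H.V) (ψ : G.E → H.E), Finite G.E →
    Nat.card G.E = n → SegInv G H ι ψ →
    ∃ H' : MGraph, Relation.ReflTransGen ContractInternalStep G H' ∧ IsIso H' H := by
  induction n using Nat.strong_induction_on with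
  | _ n ih =>
    intro G H ι ψ hfin hcard I
    by_cases ht : ∀ e, G.Internal (G.tgt e) → G.src e = G.tgt e
    · exact ⟨G, .refl, I.terminal ht⟩
    · push Not at ht
      obtain ⟨e₀, hi, hne⟩ := ht
      have hlt : Nat.card {e : G.E // e ≠ e₀} < n := by
        rw [← hcard]
        exact Finite.card_subtype_lt (x := e₀) (by simp)
      obtain ⟨H', h1, h2⟩ := ih _ hlt (_root_.ctr G e₀ hne hi) H _ _
        (inferInstanceAs (Finite {e : G.E // e ≠ e₀})) rfl I.ctr
      exact ⟨H', .head (ctr_step G e₀ hne hi) h1, h2⟩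

/-! ### Segments -/

theorem walk_iff (G : MGraph) (es : List G.E) :
    G.IsWalk es ↔ es.IsChain (fun a b => G.tgt a = G.src b) := by
  induction es with
  | nil => simp [MGraph.IsWalk]
  | cons a l ih =>
    cases l with
    | nil => simp [MGraph.IsWalk]
    | cons b l => simp [MGraph.IsWalk, ih]

theorem verts_tail (G : MGraph) (es : List G.E) : (G.walkVerts es).tail = es.map G.tgt := by
  cases es <;> simp [MGraph.walkVerts]

theorem verts_dropLast (G : MGraph) (es : List G.E) (h : G.IsWalk es) :
    (G.walkVerts es).dropLast = es.map G.src := by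
  induction es with
  | nil => simp [MGraph.walkVerts]
  | cons a l ih =>
    cases l with
    | nil => simp [MGraph.walkVerts]
    | cons b l =>
      have h2 := ih h.2
      simp only [MGraph.walkVerts, List.map_cons] at h2 ⊢
      rw [h.1, List.dropLast_cons_of_ne_nil (by simp), h2]

theorem path_iff (G : MGraph) (es : List G.E) : G.IsInternalPath es ↔
    es ≠ [] ∧ es.IsChain (fun a b => G.tgt a = G.src b) ∧
    (∀ e ∈ es.dropLast, G.Internal (G.tgt e)) ∧ (es.map G.tgt).Nodup ∧ (es.map G.src).Nodup := by
  unfold MGraph.IsInternalPath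
  rw [walk_iff, verts_tail]
  refine and_congr_right fun _ => and_congr_right fun h => ?_
  rw [verts_dropLast G es ((walk_iff G es).2 h), ← List.map_dropLast, List.forall_mem_map]

theorem path_exists (G : MGraph) [Finite G.E] (e : G.E) : ∃ es, G.IsSegment es ∧ e ∈ es := by
  classical
  have := Fintype.ofFinite G.E
  let P : ℕ → Prop := fun n => ∃ es, G.IsInternalPath es ∧ e ∈ es ∧ es.length = n
  have hb : ∀ n, P n → n ≤ Fintype.card G.E := by
    rintro n ⟨es, h, -, rfl⟩
    rw [path_iff] at h
    exact (List.Nodup.of_map _ h.2.2.2.1).length_le_card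
  have h1 : P 1 := ⟨[e], by rw [path_iff]; simp, by simp, rfl⟩
  obtain ⟨es, h, he, hl⟩ := Nat.findGreatest_spec (P := P) (hb 1 h1) h1
  have hmax : ∀ es', G.IsInternalPath es' → e ∈ es' → es'.length ≤ es.length := by
    intro es' h' he'
    rw [hl]
    exact Nat.le_findGreatest (hb _ ⟨es', h', he', rfl⟩) ⟨es', h', he', rfl⟩
  refine ⟨es, ⟨h, ?_, ?_⟩, he⟩
  · intro a ha
    have := hmax _ ha (by simp [he])
    simp at this
  · intro a ha
    have := hmax _ ha (by simp [he])
    simp at this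

theorem seg_adj_right {G : MGraph} {es : List G.E} (hs : G.IsSegment es) {e e' : G.E}
    (h : EAdj G e e') (he : e ∈ es) : e' ∈ es := by
  obtain ⟨hp, -, hr⟩ := hs
  rw [path_iff] at hp
  obtain ⟨hne, hc, hint, hnt, hns⟩ := hp
  obtain ⟨l₁, l₂, rfl⟩ := List.append_of_mem he
  cases l₂ with
  | cons b l₂ =>
    have : G.tgt e = G.src b := by
      have := (List.isChain_append.1 hc).2.1
      exact (List.isChain_cons_cons.1 this).1
    have : e' = b := Internal_src_unique h.2 h.1.symm this.symm
    simp [this]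
  | nil =>
    by_contra hne'
    apply hr e'
    have hall : ∀ a ∈ l₁ ++ [e], G.Internal (G.tgt a) := by
      intro a ha
      rcases List.mem_append.1 ha with ha | ha
      · exact hint a (by simpa using ha)
      · rw [List.mem_singleton.1 ha]; exact h.2
    rw [path_iff]
    refine ⟨by simp, ?_, ?_, ?_, ?_⟩
    · rw [List.isChain_append]
      refine ⟨hc, by simp, ?_⟩
      intro x hx y hy
      simp at hx hy
      subst hx; subst hy; exact h.1
    · rw [List.dropLast_concat]; exact hall
    · rw [List.map_append, List.nodup_append]
      refine ⟨hnt, by simp, ?_⟩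
      intro a ha b hb hab
      obtain ⟨c, hc, rfl⟩ := List.mem_map.1 ha
      simp at hb
      subst hb
      exact hne' (Internal_tgt_unique (hall c hc) rfl hab.symm ▸ hc)
    · rw [List.map_append, List.nodup_append]
      refine ⟨hns, by simp, ?_⟩
      intro a ha b hb hab
      obtain ⟨c, hc, rfl⟩ := List.mem_map.1 ha
      simp at hb
      subst hb
      exact hne' (Internal_src_unique h.2 (hab.trans h.1.symm) h.1.symm ▸ hc)

theorem chain_src_internal {G : MGraph} {a : G.E} {l : List G.E}
    (hc : (a :: l).IsChain (fun a b => G.tgt a = G.src b))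
    (hint : ∀ e ∈ (a :: l).dropLast, G.Internal (G.tgt e)) : ∀ e ∈ l, G.Internal (G.src e) := by
  induction l generalizing a with
  | nil => simp
  | cons b l ih =>
    rw [List.isChain_cons_cons] at hc
    intro e he
    rcases List.mem_cons.1 he with rfl | he
    · rw [← hc.1]; exact hint a (by simp)
    · exact ih hc.2 (fun e he => hint e (by simp at he ⊢; exact Or.inr he)) e he

theorem seg_adj_left {G : MGraph} {es : List G.E} (hs : G.IsSegment es) {e e' : G.E}
    (h : EAdj G e e') (he : e' ∈ es) : e ∈ es := by
  obtain ⟨hp, hr, -⟩ := hs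
  rw [path_iff] at hp
  obtain ⟨hne, hc, hint, hnt, hns⟩ := hp
  obtain ⟨l₁, l₂, rfl⟩ := List.append_of_mem he
  rcases List.eq_nil_or_concat l₁ with rfl | ⟨l₁, b, rfl⟩
  · by_contra hne'
    apply hr e
    have hi' : G.Internal (G.src e') := h.1 ▸ h.2
    have hall : ∀ a ∈ e' :: l₂, G.Internal (G.src a) := by
      intro a ha
      rcases List.mem_cons.1 ha with rfl | ha
      · exact hi'
      · exact chain_src_internal hc hint a ha
    rw [List.nil_append] at *
    rw [path_iff]
    refine ⟨by simp, ?_, ?_, ?_, ?_⟩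
    · exact List.isChain_cons_cons.2 ⟨h.1, hc⟩
    · intro a ha
      rw [List.dropLast_cons_of_ne_nil (by simp)] at ha
      rcases List.mem_cons.1 ha with rfl | ha
      · exact h.2
      · exact hint a ha
    · rw [List.map_cons, List.nodup_cons]
      refine ⟨?_, hnt⟩
      intro ha
      obtain ⟨c, hc, hc'⟩ := List.mem_map.1 ha
      exact hne' (Internal_tgt_unique h.2 hc' rfl ▸ hc)
    · rw [List.map_cons, List.nodup_cons]
      refine ⟨?_, hns⟩
      intro ha
      obtain ⟨c, hc, hc'⟩ := List.mem_map.1 ha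
      exact hne' (Internal_src_unique (hall c hc) rfl hc'.symm ▸ hc)
  · have : G.tgt b = G.src e' := by
      have := (List.isChain_append.1 hc).2.2
      exact this b (by simp) e' (by simp)
    have : e = b := Internal_tgt_unique h.2 rfl (this.trans h.1.symm)
    simp [this]

theorem seg_eqv {G : MGraph} {es : List G.E} (hs : G.IsSegment es) {e e' : G.E}
    (h : Relation.EqvGen (EAdj G) e e') : e ∈ es ↔ e' ∈ es := by
  induction h with
  | rel a b h => exact ⟨seg_adj_right hs h, seg_adj_left hs h⟩
  | refl => rfl
  | symm a b _ ih => exact ih.symm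
  | trans a b c _ _ h1 h2 => exact h1.trans h2

theorem chain_conn {G : MGraph} {a : G.E} {l : List G.E}
    (hc : (a :: l).IsChain (fun a b => G.tgt a = G.src b))
    (hint : ∀ e ∈ (a :: l).dropLast, G.Internal (G.tgt e)) :
    ∀ e ∈ a :: l, Relation.EqvGen (EAdj G) a e := by
  induction l generalizing a with
  | nil => intro e he; rw [List.mem_singleton.1 he]; exact .refl _
  | cons b l ih =>
    rw [List.isChain_cons_cons] at hc
    intro e he
    rcases List.mem_cons.1 he with rfl | he
    · exact .refl _
    · exact .trans _ b _ (.rel _ _ ⟨hc.1, hint a (by simp)⟩)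
        (ih hc.2 (fun e he => hint e (by
          rw [List.dropLast_cons_of_ne_nil (by simp)]; exact List.mem_cons_of_mem _ he)) e he)

theorem seg_conn {G : MGraph} {es : List G.E} (hs : G.IsSegment es) {e e' : G.E}
    (he : e ∈ es) (he' : e' ∈ es) : Relation.EqvGen (EAdj G) e e' := by
  have hp := (path_iff G es).1 hs.1
  cases es with
  | nil => simp at he
  | cons a l =>
    have := chain_conn hp.2.1 hp.2.2.1
    exact .trans _ a _ (.symm _ _ (this e he)) (this e' he')

theorem seg_first {G : MGraph} {es : List G.E} (hs : G.IsSegment es) {e : G.E}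
    (he : e ∈ es) (hx : G.External (G.src e)) : G.firstV es = some (G.src e) := by
  have hp := (path_iff G es).1 hs.1
  cases es with
  | nil => simp at he
  | cons a l =>
    rcases List.mem_cons.1 he with rfl | he
    · rfl
    · exact absurd (chain_src_internal hp.2.1 hp.2.2.1 e he) hx

theorem seg_last {G : MGraph} {es : List G.E} (hs : G.IsSegment es) {e : G.E}
    (he : e ∈ es) (hx : G.External (G.tgt e)) : G.lastV es = some (G.tgt e) := by
  have hp := (path_iff G es).1 hs.1
  rcases List.eq_nil_or_concat es with rfl | ⟨l, a, rfl⟩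
  · simp at he
  · rw [List.concat_eq_append] at *
    rw [List.mem_append] at he
    rcases he with he | he
    · exact absurd (hp.2.2.1 e (by simpa using he)) hx
    · rw [List.mem_singleton.1 he]; simp [MGraph.lastV]

theorem verts_internal {G : MGraph} {es : List G.E}
    (h : ∀ e ∈ es, G.Internal (G.src e) ∧ G.Internal (G.tgt e)) :
    ∀ x ∈ G.walkVerts es, G.Internal x := by
  cases es with
  | nil => simp [MGraph.walkVerts]
  | cons a l =>
    intro x hx
    simp only [MGraph.walkVerts, List.mem_cons, List.mem_map] at hx
    rcases hx with rfl | rfl | ⟨e, he, rfl⟩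
    · exact (h a (by simp)).1
    · exact (h a (by simp)).2
    · exact (h e (by simp [he])).2

theorem SegInv.base {G H : MGraph} [Finite G.E] (hSG : IsSegmentGraph G H) :
    ∃ ι ψ, SegInv G H ι ψ := by
  classical
  obtain ⟨ι, β, hι, hβ, huniq, -, hsrc, htgt, hcyc, hfresh, hcover⟩ := hSG
  have hex : ∀ e, ∃ h, e ∈ β h := by
    intro e
    obtain ⟨es, hes, he⟩ := path_exists G e
    obtain ⟨h, hh, -⟩ := huniq es hes
    exact ⟨h, (Set.ext_iff.1 hh e).2 he⟩
  choose ψ hψ using hex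
  have hβinj : ∀ h h', ({x | x ∈ β h} : Set G.E) = {x | x ∈ β h'} → h = h' := by
    intro h h' heq
    exact (huniq _ (hβ h')).unique heq rfl
  have hmem : ∀ e h, e ∈ β h → ψ e = h := by
    intro e h he
    apply hβinj
    ext x
    constructor
    · intro hx; exact (seg_eqv (hβ h) (seg_conn (hβ _) (hψ e) hx)).1 he
    · intro hx; exact (seg_eqv (hβ _) (seg_conn (hβ h) he hx)).1 (hψ e)
  let ι' : G.V → H.V := fun v => if h : G.Internal v then H.src (ψ h.2.2.choose) else ι ⟨v, h⟩
  have hι' : ∀ v (h : G.External v), ι' v = ι ⟨v, h⟩ := fun v h => dif_neg h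
  have hrange : ∀ w, (∀ v, G.External v → ι' v ≠ w) ↔ w ∉ Set.range ι := by
    intro w
    constructor
    · rintro h ⟨⟨v, hv⟩, rfl⟩; exact h v hv (hι' v hv)
    · rintro h v hv rfl; exact h ⟨⟨v, hv⟩, (hι' v hv).symm⟩
  refine ⟨ι', ψ, ?_, ?_, ?_, ?_, ?_, ?_, ?_, ?_, ?_⟩
  · intro h
    obtain ⟨e, he⟩ := List.exists_mem_of_ne_nil _ (hβ h).1.1
    exact ⟨e, hmem e h he⟩
  · intro e e' h
    exact (hmem e' _ (seg_adj_right (hβ _) h (hψ e))).symm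
  · intro e e' h
    exact seg_conn (hβ _) (hψ e) (h ▸ hψ e')
  · intro u v hu hv h
    rw [hι' u hu, hι' v hv] at h
    exact congrArg Subtype.val (hι h)
  · intro e he
    rw [hι' _ he]
    exact hsrc _ _ he (seg_first (hβ _) (hψ e) he)
  · intro e he
    rw [hι' _ he]
    exact htgt _ _ he (seg_last (hβ _) (hψ e) he)
  · intro h hh
    rw [hrange]
    exact hcyc h (verts_internal fun e he => hh e (hmem e h he))
  · intro h h' h1 h2 h3
    rw [hrange] at h1 h2
    exact hβinj _ _ (hfresh h h' h1 h2 h3)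
  · intro w
    rcases hcover w with ⟨⟨v, hv⟩, rfl⟩ | ⟨h, h1, h2, h3⟩
    · exact Or.inl ⟨v, hv, hι' v hv⟩
    · refine Or.inr ⟨h, h1, h2, ?_⟩
      rw [hrange, ← h1]; exact h3

theorem step_minor {G H : MGraph} (h : ContractInternalStep G H) : MinorStep G H := by
  obtain ⟨e₀, f, g, -, -, h1, h2, h3, h4, h5, -⟩ := h
  exact Or.inr (Or.inr (Or.inr ⟨e₀, f, g, h1, h2, h3, h4, h5⟩))

/-- The segment graph of a finite multigraph can be obtained by a sequence of
contractions of internal vertices; in particular, it is a minor of the graph. -/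
theorem segment_graph_by_contractions (G H : MGraph) [Finite G.V] [Finite G.E]
    (hSG : IsSegmentGraph G H) :
    (∃ H' : MGraph, Relation.ReflTransGen ContractInternalStep G H' ∧ IsIso H' H) ∧
      IsMinorOf H G := by
  obtain ⟨ι, ψ, I⟩ := SegInv.base hSG
  obtain ⟨H', h1, h2⟩ := SegInv.main _ G H ι ψ inferInstance rfl I
  refine ⟨⟨H', h1, h2⟩, ?_⟩
  have h3 : Relation.ReflTransGen MinorStep G H' := by
    clear h2
    induction h1 with
    | refl => exact .refl
    | tail _ h ih => exact ih.tail (step_minor h)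
  exact h3.tail (Or.inl h2)
end

section
/- Let γ be a directed multigraph (underlying graph of a CRPQ) and let ξ be obtained from γ by, for each edge, either contracting it, deleting it after it becomes an isolated-vertex situation, or subdividing it into a directed path of fresh internal vertices. Then the segment graph of ξ is a minor of γ. -/
/-- An edge contraction step carrying the output set along. -/
def ContractionStepO (G H : MGraph) : Prop :=
  ∃ (e₀ : G.E) (f : G.V → H.V) (g : {e : G.E // e ≠ e₀} → H.E),
    Function.Surjective f ∧ Function.Bijective g ∧
    (∀ u v, f u = f v ↔
      (u = v ∨ (u = G.src e₀ ∧ v = G.tgt e₀) ∨ (u = G.tgt e₀ ∧ v = G.src e₀))) ∧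
    (∀ e, H.src (g e) = f (G.src e.1)) ∧ (∀ e, H.tgt (g e) = f (G.tgt e.1)) ∧
    H.out = f '' G.out

/-- Deletion of an isolated non-output vertex. -/
def IsolatedVertexDeletionO (G H : MGraph) : Prop :=
  ∃ (v₀ : G.V) (hs : ∀ e, G.src e ≠ v₀) (ht : ∀ e, G.tgt e ≠ v₀)
    (f : {v : G.V // v ≠ v₀} → H.V) (g : G.E → H.E),
    v₀ ∉ G.out ∧ Function.Bijective f ∧ Function.Bijective g ∧
    (∀ e, H.src (g e) = f ⟨G.src e, hs e⟩) ∧ (∀ e, H.tgt (g e) = f ⟨G.tgt e, ht e⟩) ∧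
    (∀ v : {v : G.V // v ≠ v₀}, f v ∈ H.out ↔ v.1 ∈ G.out)

/-- Subdivision of the edge `e₀` into a directed path through `k` fresh internal
(non-output) vertices. -/
def SubdivisionStep (G H : MGraph) : Prop :=
  ∃ (e₀ : G.E) (k : ℕ) (f : G.V → H.V) (wv : Fin k → H.V)
    (g : {e : G.E // e ≠ e₀} → H.E) (p : Fin (k + 1) → H.E),
    Function.Injective f ∧ Function.Injective wv ∧
    Function.Injective g ∧ Function.Injective p ∧
    (∀ v : H.V, (∃ u, f u = v) ∨ (∃ i, wv i = v)) ∧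
    (∀ u i, f u ≠ wv i) ∧
    (∀ e : H.E, (∃ e', g e' = e) ∨ (∃ i, p i = e)) ∧
    (∀ e' i, g e' ≠ p i) ∧
    (∀ e', H.src (g e') = f (G.src e'.1) ∧ H.tgt (g e') = f (G.tgt e'.1)) ∧
    H.src (p 0) = f (G.src e₀) ∧ H.tgt (p (Fin.last k)) = f (G.tgt e₀) ∧
    (∀ i : Fin k, H.tgt (p i.castSucc) = wv i ∧ H.src (p i.succ) = wv i) ∧
    (∀ u, f u ∈ H.out ↔ u ∈ G.out) ∧ (∀ i, wv i ∉ H.out)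

namespace SegMinor
open Relation

/-- `H` arises from `P` by contracting all edges outside the range of `φ` and deleting
the vertices on which `ρ` is undefined. -/
structure Model (P H : MGraph) where
  φ : H.E → P.E
  ρ : P.V → Option H.V
  inj : Function.Injective φ
  hs : ∀ a, ρ (P.src (φ a)) = some (H.src a)
  ht : ∀ a, ρ (P.tgt (φ a)) = some (H.tgt a)
  hc : ∀ e, e ∉ Set.range φ → ρ (P.src e) = ρ (P.tgt e)
  conn : ∀ u v h, ρ u = some h → ρ v = some h →
    EqvGen (fun x y => ∃ e, e ∉ Set.range φ ∧ P.src e = x ∧ P.tgt e = y) u v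
  surj : ∀ h, ∃ v, ρ v = some h

/-- Every vertex of `H` not meeting an output is not of degree (1,1), or carries a loop. -/
def Model.Red {P H : MGraph} (M : Model P H) : Prop :=
  ∀ h, (∃ v ∈ P.out, M.ρ v = some h) ∨
    ¬ ((∃! a, H.tgt a = h) ∧ (∃! a, H.src a = h)) ∨ ∃ a, H.src a = h ∧ H.tgt a = h

theorem eqvGen_map {α β : Type} {r : α → α → Prop} {s : β → β → Prop} (f : α → β)
    (h : ∀ x y, r x y → EqvGen s (f x) (f y)) {x y : α} (hxy : EqvGen r x y) :
    EqvGen s (f x) (f y) := by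
  induction hxy with
  | rel x y hr => exact h x y hr
  | refl x => exact EqvGen.refl _
  | symm x y _ ih => exact EqvGen.symm _ _ ih
  | trans x y z _ _ ih1 ih2 => exact EqvGen.trans _ _ _ ih1 ih2

open Classical in
theorem Model.minor (n : ℕ) : ∀ (P H : MGraph) [Finite P.V] [Finite P.E] (_ : Model P H),
    Nat.card P.V + Nat.card P.E = n → IsMinorOf H P := by
  induction n using Nat.strong_induction_on with
  | _ n ih =>
  intro P H _ _ M hn
  by_cases h1 : ∃ e₀, e₀ ∉ Set.range M.φ
  · obtain ⟨e₀, he₀⟩ := h1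
    let c : P.V → P.V := fun v => if v = P.tgt e₀ then P.src e₀ else v
    let f : P.V → Set.range c := fun v => ⟨c v, v, rfl⟩
    let Q : MGraph :=
      { V := Set.range c, E := {e : P.E // e ≠ e₀}, src := fun e => f (P.src e.1),
        tgt := fun e => f (P.tgt e.1), out := ∅ }
    have hρ : ∀ v, M.ρ (c v) = M.ρ v := by
      intro v
      by_cases hv : v = P.tgt e₀
      · simp only [c, hv, if_true]; exact M.hc e₀ he₀
      · simp only [c, hv, if_false]
    have hne : ∀ a, M.φ a ≠ e₀ := fun a h => he₀ ⟨a, h⟩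
    have fsurj : ∀ x : Set.range c, ∃ v, f v = x := by
      rintro ⟨_, v, rfl⟩; exact ⟨v, rfl⟩
    have hstep : MinorStep P Q := by
      refine Or.inr (Or.inr (Or.inr ⟨e₀, f, id, fsurj, Function.bijective_id, ?_,
        fun _ => rfl, fun _ => rfl⟩))
      intro u v
      simp only [f, c]
      split_ifs <;> grind
    have MQ : Model Q H :=
      { φ := fun a => ⟨M.φ a, hne a⟩
        ρ := fun x => M.ρ x.1
        inj := fun a b hab => M.inj (congrArg Subtype.val hab)
        hs := fun a => (hρ _).trans (M.hs a)
        ht := fun a => (hρ _).trans (M.ht a)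
        hc := by
          rintro ⟨e, he⟩ hr
          have : e ∉ Set.range M.φ := by
            rintro ⟨a, rfl⟩; exact hr ⟨a, rfl⟩
          exact (hρ _).trans ((M.hc e this).trans (hρ _).symm)
        conn := by
          intro x y h hx hy
          obtain ⟨u, rfl⟩ := fsurj x
          obtain ⟨v, rfl⟩ := fsurj y
          have hu : M.ρ u = some h := (hρ u).symm.trans hx
          have hv : M.ρ v = some h := (hρ v).symm.trans hy
          refine eqvGen_map f ?_ (M.conn u v h hu hv)
          rintro _ _ ⟨e, he, rfl, rfl⟩
          by_cases hee : e = e₀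
          · subst hee
            have : f (P.src e) = f (P.tgt e) := by
              simp only [f, c]; split_ifs <;> simp_all
            rw [this]; exact EqvGen.refl _
          · refine EqvGen.rel _ _ ⟨⟨e, hee⟩, ?_, rfl, rfl⟩
            rintro ⟨a, ha⟩
            exact he ⟨a, congrArg Subtype.val ha⟩
        surj := by
          intro h
          obtain ⟨v, hv⟩ := M.surj h
          exact ⟨f v, (hρ v).trans hv⟩ }
    have : Finite Q.V := inferInstanceAs (Finite (Set.range c))
    have : Finite Q.E := inferInstanceAs (Finite {e : P.E // e ≠ e₀})
    have c1 : Nat.card Q.V ≤ Nat.card P.V := Finite.card_range_le c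
    have c2 : Nat.card Q.E < Nat.card P.E :=
      Finite.card_subtype_lt (p := fun e : P.E => e ≠ e₀) (x := e₀) (by simp)
    exact ReflTransGen.head hstep (ih _ (by omega) Q H MQ rfl)
  · push Not at h1
    have key : ∀ {x y}, EqvGen (fun x y => ∃ e, e ∉ Set.range M.φ ∧ P.src e = x ∧
        P.tgt e = y) x y → x = y := by
      intro x y h
      induction h with
      | rel x y h => obtain ⟨e, he, -⟩ := h; exact absurd (h1 e) he
      | refl => rfl
      | symm x y _ ih => exact ih.symm
      | trans x y z _ _ ih1 ih2 => exact ih1.trans ih2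
    by_cases h2 : ∃ v₀, M.ρ v₀ = none
    · obtain ⟨v₀, hv₀⟩ := h2
      have hsr : ∀ e, P.src e ≠ v₀ ∧ P.tgt e ≠ v₀ := by
        intro e
        obtain ⟨a, rfl⟩ := h1 e
        constructor
        · rintro rfl; rw [M.hs] at hv₀; cases hv₀
        · rintro rfl; rw [M.ht] at hv₀; cases hv₀
      let Q : MGraph :=
        { V := {v : P.V // v ≠ v₀}, E := {e : P.E // P.src e ≠ v₀ ∧ P.tgt e ≠ v₀},
          src := fun e => ⟨P.src e.1, e.2.1⟩
          tgt := fun e => ⟨P.tgt e.1, e.2.2⟩, out := ∅ }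
      have hstep : MinorStep P Q :=
        Or.inr (Or.inr (Or.inl ⟨v₀, id, id, Function.bijective_id, Function.bijective_id,
          fun _ => rfl, fun _ => rfl⟩))
      have MQ : Model Q H :=
        { φ := fun a => ⟨M.φ a, hsr _⟩
          ρ := fun x => M.ρ x.1
          inj := fun a b hab => M.inj (congrArg Subtype.val hab)
          hs := fun a => M.hs a
          ht := fun a => M.ht a
          hc := by
            rintro ⟨e, he⟩ hr
            obtain ⟨a, rfl⟩ := h1 e
            exact absurd ⟨a, rfl⟩ hr
          conn := by
            rintro ⟨x, hx'⟩ ⟨y, hy'⟩ h hx hy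
            have : x = y := key (M.conn x y h hx hy)
            subst this
            exact EqvGen.refl _
          surj := by
            intro h
            obtain ⟨v, hv⟩ := M.surj h
            exact ⟨⟨v, by rintro rfl; rw [hv₀] at hv; cases hv⟩, hv⟩ }
      have : Finite Q.V := inferInstanceAs (Finite {v : P.V // v ≠ v₀})
      have : Finite Q.E :=
        inferInstanceAs (Finite {e : P.E // P.src e ≠ v₀ ∧ P.tgt e ≠ v₀})
      have c1 : Nat.card Q.E ≤ Nat.card P.E := Finite.card_subtype_le _
      have c2 : Nat.card Q.V < Nat.card P.V :=
        Finite.card_subtype_lt (p := fun e : P.V => e ≠ v₀) (x := v₀) (by simp)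
      exact ReflTransGen.head hstep (ih _ (by omega) Q H MQ rfl)
    · have h3 : ∀ v, ∃ h, M.ρ v = some h := by
        intro v
        cases hv : M.ρ v with
        | none => exact absurd ⟨v, hv⟩ h2
        | some h => exact ⟨h, rfl⟩
      choose r hr using h3
      choose g hg using h1
      refine ReflTransGen.single (Or.inl ⟨r, g, ⟨?_, ?_⟩, ⟨?_, ?_⟩, ?_, ?_⟩)
      · intro x y hxy
        have hx := hr x
        rw [hxy] at hx
        exact key (M.conn x y _ hx (hr y))
      · intro h
        obtain ⟨v, hv⟩ := M.surj h
        exact ⟨v, by have := hr v; rw [hv] at this; exact (Option.some.inj this).symm⟩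
      · intro e e' h
        rw [← hg e, ← hg e', h]
      · intro a
        exact ⟨M.φ a, M.inj (hg _)⟩
      · intro e
        have := M.hs (g e)
        rw [hg, hr] at this
        exact (Option.some.inj this).symm
      · intro e
        have := M.ht (g e)
        rw [hg, hr] at this
        exact (Option.some.inj this).symm

end SegMinor
namespace SegMinor
open Relation

theorem contraction_back {P Q H : MGraph} (hst : ContractionStepO P Q) (M : Model Q H)
    (hM : M.Red) : ∃ M' : Model P H, M'.Red := by
  obtain ⟨e₀, f, g, fs, gb, ff, hsrc, htgt, hout⟩ := hst
  have hq : ∀ q, ∃ e, g e = q := gb.2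
  choose k hk using hq
  have kg : ∀ e, k (g e) = e := fun e => gb.1 (hk _)
  have f0 : f (P.src e₀) = f (P.tgt e₀) := (ff _ _).2 (Or.inr (Or.inl ⟨rfl, rfl⟩))
  have ks : ∀ q, f (P.src (k q).1) = Q.src q := fun q => by rw [← hsrc, hk]
  have kt : ∀ q, f (P.tgt (k q).1) = Q.tgt q := fun q => by rw [← htgt, hk]
  have hr : ∀ e (he : e ≠ e₀), e ∉ Set.range (fun a => (k (M.φ a)).1) →
      g ⟨e, he⟩ ∉ Set.range M.φ := by
    rintro e he h ⟨a, ha⟩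
    exact h ⟨a, by simp [ha, kg]⟩
  refine ⟨{ φ := fun a => (k (M.φ a)).1, ρ := fun v => M.ρ (f v), inj := ?_, hs := ?_,
            ht := ?_, hc := ?_, conn := ?_, surj := ?_ }, ?_⟩
  · intro a b hab
    have : k (M.φ a) = k (M.φ b) := Subtype.ext hab
    apply M.inj
    rw [← hk (M.φ a), this, hk]
  · intro a
    simp only [ks, M.hs]
  · intro a
    simp only [kt, M.ht]
  · intro e he
    by_cases h : e = e₀
    · subst h; simp only [f0]
    · have := M.hc _ (hr e h he)
      rw [hsrc, htgt] at this
      exact this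
  · intro u v h hu hv
    have key : ∀ {x y}, EqvGen (fun x y => ∃ e, e ∉ Set.range M.φ ∧ Q.src e = x ∧
        Q.tgt e = y) x y → ∀ u v, f u = x → f v = y →
        EqvGen (fun x y => ∃ e, e ∉ Set.range (fun a => (k (M.φ a)).1) ∧ P.src e = x ∧
        P.tgt e = y) u v := by
      have e0rel : EqvGen (fun x y => ∃ e, e ∉ Set.range (fun a => (k (M.φ a)).1) ∧
          P.src e = x ∧ P.tgt e = y) (P.src e₀) (P.tgt e₀) := by
        refine EqvGen.rel _ _ ⟨e₀, ?_, rfl, rfl⟩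
        rintro ⟨a, ha⟩
        exact (k (M.φ a)).2 ha
      have eqf : ∀ u v, f u = f v →
          EqvGen (fun x y => ∃ e, e ∉ Set.range (fun a => (k (M.φ a)).1) ∧ P.src e = x ∧
          P.tgt e = y) u v := by
        intro u v h
        rcases (ff u v).1 h with rfl | ⟨rfl, rfl⟩ | ⟨rfl, rfl⟩
        · exact EqvGen.refl _
        · exact e0rel
        · exact e0rel.symm
      intro x y hxy
      induction hxy with
      | rel x y h =>
        obtain ⟨e, he, rfl, rfl⟩ := h
        intro u v hu hv
        have h1 := eqf u _ (hu.trans (ks e).symm)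
        have h2 := eqf _ v ((kt e).trans hv.symm)
        refine (h1.trans _ _ _ (EqvGen.rel _ _ ⟨(k e).1, ?_, rfl, rfl⟩)).trans _ _ _ h2
        rintro ⟨a, ha⟩
        apply he
        refine ⟨a, ?_⟩
        have : k (M.φ a) = k e := Subtype.ext ha
        rw [← hk (M.φ a), this, hk]
      | refl => intro u v hu hv; exact eqf u v (hu.trans hv.symm)
      | symm x y _ ih => intro u v hu hv; exact (ih v u hv hu).symm
      | trans x y z _ _ ih1 ih2 =>
        intro u v hu hv
        obtain ⟨w, hw⟩ := fs y
        exact (ih1 u w hu hw).trans _ _ _ (ih2 w v hw hv)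
    exact key (M.conn _ _ h hu hv) u v rfl rfl
  · intro h
    obtain ⟨q, hq⟩ := M.surj h
    obtain ⟨v, rfl⟩ := fs q
    exact ⟨v, hq⟩
  · intro h
    rcases hM h with ⟨v, hv, hvh⟩ | h' | h'
    · rw [hout] at hv
      obtain ⟨u, hu, rfl⟩ := hv
      exact Or.inl ⟨u, hu, hvh⟩
    · exact Or.inr (Or.inl h')
    · exact Or.inr (Or.inr h')

open Classical in
theorem deletion_back {P Q H : MGraph} (hst : IsolatedVertexDeletionO P Q) (M : Model Q H)
    (hM : M.Red) : ∃ M' : Model P H, M'.Red := by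
  obtain ⟨v₀, hs, ht, f, g, hv₀, fb, gb, hsrc, htgt, hout⟩ := hst
  have hq : ∀ q, ∃ e, g e = q := gb.2
  choose k hk using hq
  have kg : ∀ e, k (g e) = e := fun e => gb.1 (hk _)
  have hr : ∀ e, e ∉ Set.range (fun a => k (M.φ a)) → g e ∉ Set.range M.φ := by
    rintro e h ⟨a, ha⟩
    exact h ⟨a, by simp [ha, kg]⟩
  have ks : ∀ q, f ⟨P.src (k q), hs _⟩ = Q.src q := fun q => by rw [← hsrc, hk]
  have kt : ∀ q, f ⟨P.tgt (k q), ht _⟩ = Q.tgt q := fun q => by rw [← htgt, hk]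
  let ρ' : P.V → Option H.V := fun v => if h : v = v₀ then none else M.ρ (f ⟨v, h⟩)
  have hρ : ∀ v (h : v ≠ v₀), ρ' v = M.ρ (f ⟨v, h⟩) := fun v h => by simp [ρ', h]
  have hρ0 : ∀ v h, ρ' v = some h → v ≠ v₀ := by
    rintro v h hv rfl
    simp [ρ'] at hv
  have hfi : ∀ q, ∃ v, f v = q := fb.2
  choose fi hfi using hfi
  have fif : ∀ v, fi (f v) = v := fun v => fb.1 (hfi _)
  refine ⟨{ φ := fun a => k (M.φ a), ρ := ρ', inj := ?_, hs := ?_,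
            ht := ?_, hc := ?_, conn := ?_, surj := ?_ }, ?_⟩
  · intro a b hab
    have : k (M.φ a) = k (M.φ b) := hab
    apply M.inj
    rw [← hk (M.φ a), this, hk]
  · intro a
    rw [hρ _ (hs _), ks, M.hs]
  · intro a
    rw [hρ _ (ht _), kt, M.ht]
  · intro e he
    have := M.hc _ (hr e he)
    rw [hsrc, htgt] at this
    rw [hρ _ (hs _), hρ _ (ht _), this]
  · intro u v h hu hv
    have hu0 := hρ0 _ _ hu
    have hv0 := hρ0 _ _ hv
    rw [hρ _ hu0] at hu
    rw [hρ _ hv0] at hv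
    have := eqvGen_map (s := fun x y => ∃ e, e ∉ Set.range (fun a => k (M.φ a)) ∧
      P.src e = x ∧ P.tgt e = y) (fun q => (fi q).1) ?_ (M.conn _ _ h hu hv)
    · simpa [fif] using this
    · rintro _ _ ⟨q, hq, rfl, rfl⟩
      refine EqvGen.rel _ _ ⟨k q, ?_, ?_, ?_⟩
      · rintro ⟨a, ha⟩
        apply hq
        refine ⟨a, ?_⟩
        have : k (M.φ a) = k q := ha
        rw [← hk (M.φ a), this, hk]
      · rw [← ks, fif]
      · rw [← kt, fif]
  · intro h
    obtain ⟨q, hq⟩ := M.surj h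
    obtain ⟨v, rfl⟩ := fb.2 q
    exact ⟨v.1, by rw [hρ _ v.2]; exact hq⟩
  · intro h
    rcases hM h with ⟨v, hv, hvh⟩ | h' | h'
    · obtain ⟨u, rfl⟩ := fb.2 v
      exact Or.inl ⟨u.1, (hout u).1 hv, (hρ _ u.2).trans hvh⟩
    · exact Or.inr (Or.inl h')
    · exact Or.inr (Or.inr h')

open Classical in
theorem subdivision_back {P Q H : MGraph} (hst : SubdivisionStep P Q) (M : Model Q H)
    (hM : M.Red) : ∃ M' : Model P H, M'.Red := by
  obtain ⟨e₀, k, f, wv, g, p, fi, wi, gi, pi, hV, hfw, hE, hgp, hg, hp0, hpl, hpw, hfo, hwo⟩ :=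
    hst
  have tgt_wv : ∀ q m, Q.tgt q = wv m → q = p m.castSucc := by
    intro q m h
    rcases hE q with ⟨e, rfl⟩ | ⟨i, rfl⟩
    · rw [(hg e).2] at h; exact absurd h (hfw _ _)
    · induction i using Fin.lastCases with
      | last => rw [hpl] at h; exact absurd h (hfw _ _)
      | cast i => rw [(hpw i).1] at h; rw [wi h]
  have src_wv : ∀ q m, Q.src q = wv m → q = p m.succ := by
    intro q m h
    rcases hE q with ⟨e, rfl⟩ | ⟨i, rfl⟩
    · rw [(hg e).1] at h; exact absurd h (hfw _ _)
    · induction i using Fin.cases with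
      | zero => rw [hp0] at h; exact absurd h (hfw _ _)
      | succ i => rw [(hpw i).2] at h; rw [wi h]
  have consec : ∀ i j : Fin (k + 1), i < j → p i ∈ Set.range M.φ → p j ∈ Set.range M.φ →
      (∀ m, i < m → m < j → p m ∉ Set.range M.φ) → False := by
    rintro i j hij ⟨a, ha⟩ ⟨b, hb⟩ hm
    have hik : i.1 < k := by have := j.2; have : i.1 < j.1 := hij; omega
    let B : Set Q.V := {q | ∃ m : Fin k, i.1 ≤ m.1 ∧ m.1 < j.1 ∧ wv m = q}
    have hB : ∀ q, q ∉ Set.range M.φ → (Q.src q ∈ B ↔ Q.tgt q ∈ B) := by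
      intro q hq
      constructor
      · rintro ⟨m, h1, h2, h3⟩
        have := src_wv q m h3.symm
        subst this
        have hne : m.1 + 1 ≠ j.1 := by
          intro h
          apply hq
          have : m.succ = j := Fin.ext h
          rw [this]; exact ⟨b, hb⟩
        have hlt : m.1 + 1 < k := by have := j.2; omega
        refine ⟨⟨m.1 + 1, hlt⟩, by simp; omega, by simp; omega, ?_⟩
        rw [← (hpw _).1]
        rfl
      · rintro ⟨m, h1, h2, h3⟩
        have := tgt_wv q m h3.symm
        subst this
        have hne : m.1 ≠ i.1 := by
          intro h
          apply hq
          have : m.castSucc = i := Fin.ext h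
          rw [this]; exact ⟨a, ha⟩
        have hlt : m.1 - 1 < k := by have := m.2; omega
        refine ⟨⟨m.1 - 1, hlt⟩, by simp; omega, by simp; omega, ?_⟩
        rw [← (hpw _).2]
        congr 2
        apply Fin.ext
        simp; omega
    have hB' : ∀ {x y}, EqvGen (fun x y => ∃ e, e ∉ Set.range M.φ ∧ Q.src e = x ∧
        Q.tgt e = y) x y → (x ∈ B ↔ y ∈ B) := by
      intro x y h
      induction h with
      | rel x y h => obtain ⟨e, he, rfl, rfl⟩ := h; exact hB e he
      | refl => rfl
      | symm x y _ ih => exact ih.symm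
      | trans x y z _ _ ih1 ih2 => exact ih1.trans ih2
    have htw : Q.tgt (p i) = wv ⟨i.1, hik⟩ := by
      rw [← (hpw _).1]; rfl
    have hw : M.ρ (wv ⟨i.1, hik⟩) = some (H.tgt a) := by
      rw [← htw, ← ha, M.ht]
    have hbag : ∀ q, M.ρ q = some (H.tgt a) → q ∈ B := by
      intro q hq
      exact (hB' (M.conn _ _ _ hw hq)).1 ⟨_, le_refl _, hij, rfl⟩
    have hprop : ∀ n, i.1 ≤ n → ∀ (hn : n < k), n < j.1 →
        M.ρ (wv ⟨n, hn⟩) = some (H.tgt a) := by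
      intro n hn
      induction n, hn using Nat.le_induction with
      | base => intro _ _; exact hw
      | succ n hn ih =>
        intro h1 h2
        have := M.hc (p ⟨n + 1, by omega⟩) (hm _ (by show i.1 < n + 1; omega) h2)
        have e1 : Q.src (p ⟨n + 1, by omega⟩) = wv ⟨n, by omega⟩ := (hpw ⟨n, by omega⟩).2
        have e2 : Q.tgt (p ⟨n + 1, by omega⟩) = wv ⟨n + 1, h1⟩ := (hpw ⟨n + 1, h1⟩).1
        rw [e1, e2] at this
        rw [← this]
        exact ih (by omega) (by omega)
    have hij' : i.1 < j.1 := hij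
    have hj := j.2
    have hbs : H.src b = H.tgt a := by
      have h1 := hprop (j.1 - 1) (by omega) (by omega) (by omega)
      have h2 : Q.src (p j) = wv ⟨j.1 - 1, by omega⟩ := by
        rw [← (hpw _).2]
        congr 2
        apply Fin.ext
        simp; omega
      have h3 := M.hs b
      rw [hb, h2, h1] at h3
      exact (Option.some.inj h3).symm
    have ua : ∀ c, H.tgt c = H.tgt a → c = a := by
      intro c hc
      obtain ⟨m, h1, h2, h3⟩ := hbag _ ((M.ht c).trans (congrArg some hc))
      have h4 := tgt_wv _ m h3.symm
      apply M.inj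
      rw [h4, ha]
      by_contra hne
      have h5 : i < m.castSucc := by
        show i.1 < m.1
        rcases Nat.lt_or_ge i.1 m.1 with h | h
        · exact h
        · exact absurd (congrArg p (Fin.ext (by simp; omega))) hne
      exact hm _ h5 h2 ⟨c, h4⟩
    have ub : ∀ c, H.src c = H.tgt a → c = b := by
      intro c hc
      obtain ⟨m, h1, h2, h3⟩ := hbag _ ((M.hs c).trans (congrArg some hc))
      have h4 := src_wv _ m h3.symm
      apply M.inj
      rw [h4, hb]
      by_contra hne
      have h5 : m.succ < j := by
        show m.1 + 1 < j.1
        rcases Nat.lt_or_ge (m.1 + 1) j.1 with h | h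
        · exact h
        · exact absurd (congrArg p (Fin.ext (by simp; omega))) hne
      exact hm _ (by show i.1 < m.1 + 1; omega) h5 ⟨c, h4⟩
    rcases hM (H.tgt a) with ⟨v, hv, hvh⟩ | h' | ⟨c, hc1, hc2⟩
    · obtain ⟨m, -, -, rfl⟩ := hbag v hvh
      exact hwo m hv
    · exact h' ⟨⟨a, rfl, ua⟩, ⟨b, hbs, ub⟩⟩
    · have h1 := ua c hc2
      have h2 := ub c hc1
      subst h1; subst h2
      have := pi (ha.symm.trans hb)
      omega
  have noPair : ∀ n, ∀ i j : Fin (k + 1), i < j → j.1 - i.1 = n → p i ∈ Set.range M.φ →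
      p j ∈ Set.range M.φ → False := by
    intro n
    induction n using Nat.strong_induction_on with
    | _ n ih =>
      intro i j hij hn hi hj
      refine consec i j hij hi hj ?_
      intro m h1 h2 hm
      have h1' : i.1 < m.1 := h1
      have h2' : m.1 < j.1 := h2
      exact ih (m.1 - i.1) (by omega) i m h1 rfl hi hm
  obtain ⟨i, hi⟩ : ∃ i, ∀ j, j ≠ i → p j ∉ Set.range M.φ := by
    by_cases h : ∃ i, p i ∈ Set.range M.φ
    · obtain ⟨i, hi⟩ := h
      refine ⟨i, fun j hj hj' => ?_⟩
      rcases lt_or_gt_of_ne hj with h | h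
      · exact noPair _ j i h rfl hj' hi
      · exact noPair _ i j h rfl hi hj'
    · push Not at h
      exact ⟨0, fun j _ => h j⟩
  obtain ⟨r, rf, rw'⟩ : ∃ r : Q.V → P.V, (∀ u, r (f u) = u) ∧
      ∀ j, r (wv j) = if j.1 < i.1 then P.src e₀ else P.tgt e₀ := by
    have : ∀ q, ∃ u, (∀ u', f u' = q → u = u') ∧
        (∀ j, wv j = q → u = if j.1 < i.1 then P.src e₀ else P.tgt e₀) := by
      intro q
      rcases hV q with ⟨u, rfl⟩ | ⟨j, rfl⟩
      · exact ⟨u, fun u' h => (fi h).symm, fun j h => absurd h.symm (hfw _ _)⟩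
      · exact ⟨_, fun u' h => absurd h (hfw _ _), fun j' h => by rw [wi h]⟩
    choose r h1 h2 using this
    exact ⟨r, fun u => h1 _ _ rfl, fun j => h2 _ _ rfl⟩
  obtain ⟨ψ, ψg, ψp⟩ : ∃ ψ : Q.E → P.E, (∀ e, ψ (g e) = e.1) ∧ ∀ j, ψ (p j) = e₀ := by
    have : ∀ q, ∃ u, (∀ e, g e = q → u = e.1) ∧ (∀ j, p j = q → u = e₀) := by
      intro q
      rcases hE q with ⟨u, rfl⟩ | ⟨j, rfl⟩
      · exact ⟨u.1, fun u' h => by rw [gi h], fun j h => absurd h.symm (hgp _ _)⟩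
      · exact ⟨e₀, fun u' h => absurd h (hgp _ _), fun j' h => rfl⟩
    choose r h1 h2 using this
    exact ⟨r, fun u => h1 _ _ rfl, fun j => h2 _ _ rfl⟩
  have rsrc : ∀ j : Fin (k + 1), r (Q.src (p j)) =
      if j.1 ≤ i.1 then P.src e₀ else P.tgt e₀ := by
    intro j
    induction j using Fin.cases with
    | zero => rw [hp0, rf]; simp
    | succ j => rw [(hpw j).2, rw']; rfl
  have rtgt : ∀ j : Fin (k + 1), r (Q.tgt (p j)) =
      if j.1 < i.1 then P.src e₀ else P.tgt e₀ := by
    intro j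
    induction j using Fin.lastCases with
    | last =>
      rw [hpl, rf, if_neg]
      have := i.2
      simp; omega
    | cast j => rw [(hpw j).1, rw']; rfl
  have ρsrc : ∀ n (hn : n < k + 1), n ≤ i.1 →
      M.ρ (Q.src (p ⟨n, hn⟩)) = M.ρ (f (P.src e₀)) := by
    intro n
    induction n with
    | zero => intro _ _; rw [← hp0]; rfl
    | succ n ih =>
      intro hn hni
      rw [← ih (by omega) (by omega), M.hc (p ⟨n, by omega⟩)]
      · have e1 : Q.src (p ⟨n + 1, hn⟩) = wv ⟨n, by omega⟩ := (hpw ⟨n, by omega⟩).2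
        have e2 : Q.tgt (p ⟨n, by omega⟩) = wv ⟨n, by omega⟩ := (hpw ⟨n, by omega⟩).1
        rw [e1, e2]
      · apply hi
        intro h
        have := congrArg Fin.val h
        simp at this; omega
  have ρtgt : ∀ n, ∀ j : Fin (k + 1), k - j.1 = n → i.1 ≤ j.1 →
      M.ρ (Q.tgt (p j)) = M.ρ (f (P.tgt e₀)) := by
    intro n
    induction n with
    | zero =>
      intro j hj _
      have : j = Fin.last k := Fin.ext (by have := j.2; simp; omega)
      rw [this, hpl]
    | succ n ih =>
      intro j hj hij
      have hjk : j.1 < k := by omega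
      rw [← ih ⟨j.1 + 1, by omega⟩ (by simp; omega) (by simp; omega),
        ← M.hc (p ⟨j.1 + 1, by omega⟩)]
      · have e1 : Q.src (p ⟨j.1 + 1, by omega⟩) = wv ⟨j.1, hjk⟩ := (hpw ⟨j.1, hjk⟩).2
        have e2 : Q.tgt (p j) = wv ⟨j.1, hjk⟩ := (hpw ⟨j.1, hjk⟩).1
        rw [e1, e2]
      · apply hi
        intro h
        have := congrArg Fin.val h
        simp at this; omega
  have ρr : ∀ q, M.ρ (f (r q)) = M.ρ q := by
    intro q
    rcases hV q with ⟨u, rfl⟩ | ⟨j, rfl⟩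
    · rw [rf]
    · rw [rw']
      split_ifs with h
      · rw [← (hpw j).2]
        exact (ρsrc (j.1 + 1) (by omega) h).symm
      · rw [← (hpw j).1]
        exact (ρtgt _ j.castSucc rfl (by simp; omega)).symm
  have ψsrc : ∀ a, P.src (ψ (M.φ a)) = r (Q.src (M.φ a)) := by
    intro a
    rcases hE (M.φ a) with ⟨e, he⟩ | ⟨j, hj⟩
    · rw [← he, ψg, (hg e).1, rf]
    · have : j = i := by
        by_contra hne
        exact hi j hne ⟨a, hj.symm⟩
      subst this
      rw [← hj, ψp, rsrc, if_pos le_rfl]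
  have ψtgt : ∀ a, P.tgt (ψ (M.φ a)) = r (Q.tgt (M.φ a)) := by
    intro a
    rcases hE (M.φ a) with ⟨e, he⟩ | ⟨j, hj⟩
    · rw [← he, ψg, (hg e).2, rf]
    · have : j = i := by
        by_contra hne
        exact hi j hne ⟨a, hj.symm⟩
      subst this
      rw [← hj, ψp, rtgt, if_neg (lt_irrefl _)]
  have rg : ∀ e, e.1 ∈ Set.range (fun a => ψ (M.φ a)) ↔ g e ∈ Set.range M.φ := by
    intro e
    constructor
    · rintro ⟨a, ha⟩
      rcases hE (M.φ a) with ⟨e', he⟩ | ⟨j, hj⟩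
      · simp only [← he, ψg] at ha
        rw [Subtype.ext ha] at he
        exact ⟨a, he.symm⟩
      · simp only [← hj, ψp] at ha
        exact absurd ha.symm e.2
    · rintro ⟨a, ha⟩
      exact ⟨a, by simp only [ha, ψg]⟩
  have rp : e₀ ∈ Set.range (fun a => ψ (M.φ a)) ↔ p i ∈ Set.range M.φ := by
    constructor
    · rintro ⟨a, ha⟩
      rcases hE (M.φ a) with ⟨e', he⟩ | ⟨j, hj⟩
      · simp only [← he, ψg] at ha
        exact absurd ha e'.2
      · have : j = i := by
          by_contra hne
          exact hi j hne ⟨a, hj.symm⟩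
        subst this
        exact ⟨a, hj.symm⟩
    · rintro ⟨a, ha⟩
      exact ⟨a, by simp only [ha, ψp]⟩
  refine ⟨{ φ := fun a => ψ (M.φ a), ρ := fun v => M.ρ (f v), inj := ?_, hs := ?_,
            ht := ?_, hc := ?_, conn := ?_, surj := ?_ }, ?_⟩
  · intro a b hab
    apply M.inj
    simp only at hab
    rcases hE (M.φ a) with ⟨e, he⟩ | ⟨j, hj⟩
    · rcases hE (M.φ b) with ⟨e', he'⟩ | ⟨j', hj'⟩
      · rw [← he, ← he', ψg, ψg] at hab
        rw [← he, ← he', Subtype.ext hab]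
      · rw [← he, ← hj', ψg, ψp] at hab
        exact absurd hab e.2
    · rcases hE (M.φ b) with ⟨e', he'⟩ | ⟨j', hj'⟩
      · rw [← he', ← hj, ψg, ψp] at hab
        exact absurd hab.symm e'.2
      · have h1 : j = i := by
          by_contra hne
          exact hi j hne ⟨a, hj.symm⟩
        have h2 : j' = i := by
          by_contra hne
          exact hi j' hne ⟨b, hj'.symm⟩
        rw [← hj, ← hj', h1, h2]
  · intro a
    simp only [ψsrc, ρr, M.hs]
  · intro a
    simp only [ψtgt, ρr, M.ht]
  · intro e he
    by_cases h : e = e₀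
    · subst h
      have := M.hc (p i) (fun h => he (rp.2 h))
      rw [← ρr, ← ρr (Q.tgt _), rsrc, rtgt, if_pos le_rfl, if_neg (lt_irrefl _)] at this
      exact this
    · have := M.hc (g ⟨e, h⟩) (fun h' => he ((rg ⟨e, h⟩).2 h'))
      rw [(hg _).1, (hg _).2] at this
      exact this
  · intro u v h hu hv
    have := eqvGen_map (s := fun x y => ∃ e, e ∉ Set.range (fun a => ψ (M.φ a)) ∧
      P.src e = x ∧ P.tgt e = y) r ?_ (M.conn _ _ h hu hv)
    · simpa only [rf] using this
    · rintro _ _ ⟨q, hq, rfl, rfl⟩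
      rcases hE q with ⟨e, rfl⟩ | ⟨j, rfl⟩
      · rw [(hg e).1, (hg e).2, rf, rf]
        exact EqvGen.rel _ _ ⟨e.1, fun h => hq ((rg e).1 h), rfl, rfl⟩
      · rw [rsrc, rtgt]
        by_cases hji : j = i
        · subst hji
          rw [if_pos le_rfl, if_neg (lt_irrefl _)]
          exact EqvGen.rel _ _ ⟨e₀, fun h => hq (rp.1 h), rfl, rfl⟩
        · have : j.1 ≠ i.1 := fun h => hji (Fin.ext h)
          by_cases hlt : j.1 < i.1
          · rw [if_pos hlt.le, if_pos hlt]; exact EqvGen.refl _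
          · rw [if_neg (by omega), if_neg hlt]; exact EqvGen.refl _
  · intro h
    obtain ⟨q, hq⟩ := M.surj h
    exact ⟨r q, (ρr q).trans hq⟩
  · intro h
    rcases hM h with ⟨v, hv, hvh⟩ | h' | h'
    · rcases hV v with ⟨u, rfl⟩ | ⟨j, rfl⟩
      · exact Or.inl ⟨u, (hfo u).1 hv, hvh⟩
      · exact absurd hv (hwo j)
    · exact Or.inr (Or.inl h')
    · exact Or.inr (Or.inr h')

open Classical in
theorem finite_of_ne {α β : Type} [Finite β] (a : α) (g : {x : α // x ≠ a} → β)
    (hg : Function.Injective g) : Finite α := by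
  have : Finite {x : α // x ≠ a} := Finite.of_injective g hg
  refine Finite.of_injective
    (fun x => if h : x = a then none else some (⟨x, h⟩ : {x : α // x ≠ a})) ?_
  intro x y h
  by_cases hx : x = a <;> by_cases hy : y = a <;> simp_all

theorem finite_back {P Q : MGraph} [Finite Q.V] [Finite Q.E]
    (h : ContractionStepO P Q ∨ IsolatedVertexDeletionO P Q ∨ SubdivisionStep P Q) :
    Finite P.V ∧ Finite P.E := by
  rcases h with ⟨e₀, f, g, fs, gb, ff, -⟩ | ⟨v₀, hs, ht, f, g, -, fb, gb, -⟩ |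
    ⟨e₀, k, f, wv, g, p, fi, wi, gi, -⟩
  · refine ⟨Finite.of_injective (fun v => (f v, v = P.src e₀)) ?_, finite_of_ne e₀ g gb.1⟩
    intro u v h
    simp only [Prod.mk.injEq, eq_iff_iff] at h
    have := (ff u v).1 h.1
    grind
  · exact ⟨finite_of_ne v₀ f fb.1, Finite.of_injective g gb.1⟩
  · exact ⟨Finite.of_injective f fi, finite_of_ne e₀ g gi⟩

end SegMinor
namespace SegMinor
open Relation

/-- Consecutive edges joined by an internal vertex. -/
def Link (G : MGraph) (a b : G.E) : Prop := G.tgt a = G.src b ∧ G.Internal (G.tgt a)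

theorem ip_iff (G : MGraph) (es : List G.E) : G.IsInternalPath es ↔
    es ≠ [] ∧ es.IsChain (Link G) ∧ (es.map G.tgt).Nodup ∧ (es.map G.src).Nodup := by
  have h1 : ∀ es, es ≠ [] → (G.walkVerts es).tail = es.map G.tgt := by
    intro es hes
    cases es with
    | nil => exact absurd rfl hes
    | cons a l => rfl
  have h2 : ∀ es, es ≠ [] → G.IsWalk es → (G.walkVerts es).dropLast = es.map G.src := by
    intro es
    induction es with
    | nil => intro h; exact absurd rfl h
    | cons a l ih =>
      intro _ hw
      cases l with
      | nil => rfl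
      | cons b l =>
        have := ih (by simp) hw.2
        simp only [MGraph.walkVerts, List.map_cons, List.dropLast_cons_cons] at this ⊢
        rw [← this, hw.1]
  have h3 : ∀ es : List G.E, es.IsChain (Link G) ↔
      G.IsWalk es ∧ ∀ v ∈ (es.map G.tgt).dropLast, G.Internal v := by
    intro es
    induction es with
    | nil => simp [MGraph.IsWalk]
    | cons a l ih =>
      cases l with
      | nil => simp [MGraph.IsWalk]
      | cons b l =>
        rw [List.isChain_cons_cons, ih]
        simp only [MGraph.IsWalk, List.map_cons, List.dropLast_cons_cons, Link,
          List.mem_cons, forall_eq_or_imp]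
        tauto
  unfold MGraph.IsInternalPath
  by_cases hes : es = []
  · simp [hes]
  · rw [h3, h1 es hes]
    constructor
    · rintro ⟨a, b, c, d, e⟩
      rw [h2 es hes b] at e
      exact ⟨a, ⟨b, c⟩, d, e⟩
    · rintro ⟨a, ⟨b, c⟩, d, e⟩
      refine ⟨a, b, c, d, ?_⟩
      rwa [h2 es hes b]

theorem chain_prev {α : Type} {R : α → α → Prop} {l : List α} (hl : l.IsChain R) (hne : l ≠ [])
    {e : α} (he : e ∈ l) : e = l.head hne ∨ ∃ e' ∈ l, R e' e := by
  induction l with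
  | nil => exact absurd rfl hne
  | cons a l ih =>
    rcases List.mem_cons.1 he with rfl | he
    · exact Or.inl rfl
    · right
      cases l with
      | nil => cases he
      | cons b l =>
        rw [List.isChain_cons_cons] at hl
        rcases ih hl.2 (by simp) he with h | ⟨e', h1, h2⟩
        · exact ⟨a, by simp, by rw [h]; exact hl.1⟩
        · exact ⟨e', List.mem_cons_of_mem _ h1, h2⟩

theorem chain_next {α : Type} {R : α → α → Prop} {l : List α} (hl : l.IsChain R) (hne : l ≠ [])
    {e : α} (he : e ∈ l) : e = l.getLast hne ∨ ∃ e' ∈ l, R e e' := by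
  have := chain_prev (R := fun a b => R b a) (l := l.reverse) (List.isChain_reverse.2 hl)
    (by simpa using hne) (e := e) (by simpa using he)
  simpa using this

theorem chain_all {α : Type} {R : α → α → Prop} {S : α → Prop} {l : List α} (hl : l.IsChain R)
    (hR : ∀ a ∈ l, ∀ b ∈ l, R a b → (S a ↔ S b)) {e : α} (he : e ∈ l) (hS : S e) :
    ∀ x ∈ l, S x := by
  induction l generalizing e with
  | nil => cases he
  | cons a l ih =>
    cases l with
    | nil => simp at he ⊢; rwa [← he]
    | cons b l =>
      rw [List.isChain_cons_cons] at hl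
      have hab : S a ↔ S b := hR a (by simp) b (by simp) hl.1
      have ih' := fun {e} => ih (e := e) hl.2
        (fun a ha b hb => hR a (List.mem_cons_of_mem _ ha) b (List.mem_cons_of_mem _ hb))
      have hb : S b := by
        rcases List.mem_cons.1 he with rfl | he
        · exact hab.1 hS
        · exact ih' he hS b (by simp)
      intro x hx
      rcases List.mem_cons.1 hx with rfl | hx
      · exact hab.2 hb
      · exact ih' (e := b) (by simp) hb x hx

theorem inj_of_nodup_map {α β : Type} {f : α → β} {l : List α} (h : (l.map f).Nodup)
    {a b : α} (ha : a ∈ l) (hb : b ∈ l) (hab : f a = f b) : a = b :=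
  List.inj_on_of_nodup_map h ha hb hab

/-- no edge of a path links to its head, unless it is the last one -/
theorem not_link_head {G : MGraph} {l : List G.E} (hl : l.IsChain (Link G))
    (hn : (l.map G.src).Nodup) (hne : l ≠ []) {e : G.E} (he : e ∈ l)
    (h : G.tgt e = G.src (l.head hne)) : e = l.getLast hne := by
  cases l with
  | nil => exact absurd rfl hne
  | cons a l =>
    have key : ∀ (l : List G.E) (hne : l ≠ []), l.IsChain (Link G) → ∀ e ∈ l,
        e = l.getLast hne ∨ ∃ e' ∈ l.tail, Link G e e' := by
      intro l
      induction l with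
      | nil => intro h; exact absurd rfl h
      | cons a l ih =>
        intro _ hl e he
        cases l with
        | nil => left; simpa using he
        | cons b l =>
          rw [List.isChain_cons_cons] at hl
          rcases List.mem_cons.1 he with rfl | he
          · exact Or.inr ⟨b, by simp, hl.1⟩
          · rcases ih (by simp) hl.2 e he with h | ⟨e', h1, h2⟩
            · left; rw [h]; simp
            · exact Or.inr ⟨e', List.mem_of_mem_tail h1, h2⟩
    rcases key (a :: l) (by simp) hl e he with h' | ⟨e', h1, h2⟩
    · exact h'
    · exfalso
      simp only [List.map_cons, List.nodup_cons] at hn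
      apply hn.1
      have h3 : G.src e' = G.src a := h2.1.symm.trans h
      rw [← h3]
      exact List.mem_map_of_mem h1

theorem first_internal {G : MGraph} {es : List G.E} (hip : G.IsInternalPath es)
    (hmax : ∀ e, ¬ G.IsInternalPath (e :: es)) (hne : es ≠ [])
    (hi : G.Internal (G.src (es.head hne))) :
    G.tgt (es.getLast hne) = G.src (es.head hne) := by
  rw [ip_iff] at hip
  obtain ⟨-, hch, hnt, hns⟩ := hip
  by_contra hcl
  obtain ⟨e, he, -⟩ := hi.2.1
  have hvt : G.src (es.head hne) ∉ es.map G.tgt := by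
    intro h
    obtain ⟨e', he', h⟩ := List.mem_map.1 h
    have := not_link_head hch hns hne he' h
    rw [this] at h
    exact hcl h
  apply hmax e
  rw [ip_iff]
  refine ⟨by simp, ?_, ?_, ?_⟩
  · cases es with
    | nil => exact absurd rfl hne
    | cons a l =>
      rw [List.isChain_cons_cons]
      refine ⟨⟨he, ?_⟩, hch⟩
      rw [he]; exact hi
  · simp only [List.map_cons, List.nodup_cons]
    rw [he]
    exact ⟨hvt, hnt⟩
  · simp only [List.map_cons, List.nodup_cons]
    refine ⟨?_, hns⟩
    intro h
    obtain ⟨e', he', h⟩ := List.mem_map.1 h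
    have hint : G.Internal (G.src e') := by
      rcases chain_prev hch hne he' with rfl | ⟨e'', -, h''⟩
      · exact hi
      · rw [← h''.1]; exact h''.2
    have : e = e' := hint.2.2.unique h.symm rfl
    subst this
    apply hvt
    rw [← he]
    exact List.mem_map_of_mem he'

/-- Reversal of all edges. -/
abbrev rev (G : MGraph) : MGraph := { V := G.V, E := G.E, src := G.tgt, tgt := G.src, out := G.out }

theorem rev_internal {G : MGraph} {v : G.V} : (rev G).Internal v ↔ G.Internal v := by
  unfold MGraph.Internal
  exact and_congr_right fun _ => and_comm

theorem rev_ip {G : MGraph} {es : List G.E} :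
    (rev G).IsInternalPath es.reverse ↔ G.IsInternalPath es := by
  rw [ip_iff, ip_iff]
  have h1 : List.IsChain (Link (rev G)) es.reverse ↔ es.IsChain (Link G) := by
    have : (fun a b => Link (rev G) b a) = Link G := by
      funext a b
      apply propext
      unfold Link
      rw [rev_internal]
      show G.src b = G.tgt a ∧ G.Internal (G.src b) ↔ _
      constructor
      · rintro ⟨h, h'⟩; exact ⟨h.symm, h ▸ h'⟩
      · rintro ⟨h, h'⟩; exact ⟨h.symm, h ▸ h'⟩
    rw [← this]
    exact List.isChain_reverse
  have h2 : (List.map (rev G).tgt es.reverse).Nodup ↔ (es.map G.src).Nodup := by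
    rw [List.map_reverse, List.nodup_reverse]
  have h3 : (List.map (rev G).src es.reverse).Nodup ↔ (es.map G.tgt).Nodup := by
    rw [List.map_reverse, List.nodup_reverse]
  rw [h2, h3]
  refine and_congr (not_congr List.reverse_eq_nil_iff) (and_congr h1 and_comm)

theorem last_internal {G : MGraph} {es : List G.E} (hip : G.IsInternalPath es)
    (hmax : ∀ e, ¬ G.IsInternalPath (es ++ [e])) (hne : es ≠ [])
    (hi : G.Internal (G.tgt (es.getLast hne))) :
    G.tgt (es.getLast hne) = G.src (es.head hne) := by
  have hne' : es.reverse ≠ [] := by simpa using hne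
  have hmax' : ∀ e, ¬ (rev G).IsInternalPath (e :: es.reverse) := by
    intro e h
    apply hmax e
    rw [← rev_ip, List.reverse_append]
    exact h
  have e1 : (es.reverse).head hne' = es.getLast hne := by simp
  have e2 : (es.reverse).getLast hne' = es.head hne := by simp
  have := first_internal (G := rev G) (rev_ip.2 hip) hmax' hne' (by
    rw [rev_internal]
    show G.Internal (G.tgt ((es.reverse).head hne'))
    rw [e1]; exact hi)
  have this' : G.src ((es.reverse).getLast hne') = G.tgt ((es.reverse).head hne') := this
  rw [e1, e2] at this'
  exact this'.symm

theorem seg_next {G : MGraph} {es : List G.E} (h : G.IsSegment es) {e e' : G.E} (he : e ∈ es)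
    (hi : G.Internal (G.tgt e)) (hee : G.tgt e = G.src e') : e' ∈ es := by
  have hip := (ip_iff G es).1 h.1
  rcases chain_next hip.2.1 hip.1 he with rfl | ⟨e'', h1, h2⟩
  · have := last_internal h.1 h.2.2 hip.1 hi
    have : e' = es.head hip.1 := hi.2.2.unique hee.symm this.symm
    rw [this]; exact List.head_mem _
  · have : e' = e'' := hi.2.2.unique hee.symm h2.1.symm
    rw [this]; exact h1

theorem seg_prev {G : MGraph} {es : List G.E} (h : G.IsSegment es) {e e' : G.E} (he : e ∈ es)
    (hi : G.Internal (G.src e)) (hee : G.tgt e' = G.src e) : e' ∈ es := by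
  have hip := (ip_iff G es).1 h.1
  rcases chain_prev hip.2.1 hip.1 he with rfl | ⟨e'', h1, h2⟩
  · have := first_internal h.1 h.2.1 hip.1 hi
    have : e' = es.getLast hip.1 := hi.2.1.unique hee this
    rw [this]; exact List.getLast_mem _
  · have : e' = e'' := hi.2.1.unique hee h2.1
    rw [this]; exact h1

theorem seg_sub {G : MGraph} {s t : List G.E} (hs : G.IsSegment s) (ht : G.IsSegment t)
    {e : G.E} (h1 : e ∈ s) (h2 : e ∈ t) : ∀ x ∈ s, x ∈ t := by
  have hip := (ip_iff G s).1 hs.1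
  refine chain_all (S := fun x => x ∈ t) hip.2.1 ?_ h1 h2
  intro a _ b _ hab
  exact ⟨fun ha => seg_next ht ha hab.2 hab.1, fun hb => seg_prev ht hb (hab.1 ▸ hab.2) hab.1⟩

theorem seg_exists (G : MGraph) [Finite G.V] (e : G.E) : ∃ es, G.IsSegment es ∧ e ∈ es := by
  have := Fintype.ofFinite G.V
  have hb : ∀ es, G.IsInternalPath es → es.length ≤ Fintype.card G.V := by
    intro es h
    rw [ip_iff] at h
    have := h.2.2.1.length_le_card
    simpa using this
  let S : Set ℕ := {n | ∃ es, G.IsInternalPath es ∧ e ∈ es ∧ es.length = n}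
  have hS1 : S.Nonempty := ⟨1, [e], by rw [ip_iff]; simp, by simp, rfl⟩
  have hS2 : BddAbove S := ⟨Fintype.card G.V, by rintro _ ⟨es, h, -, rfl⟩; exact hb es h⟩
  obtain ⟨es, h1, h2, h3⟩ := Nat.sSup_mem hS1 hS2
  refine ⟨es, ⟨h1, ?_, ?_⟩, h2⟩
  · intro x hx
    have : (x :: es).length ≤ sSup S := le_csSup hS2 ⟨_, hx, by simp [h2], rfl⟩
    simp at this; omega
  · intro x hx
    have : (es ++ [x]).length ≤ sSup S := le_csSup hS2 ⟨_, hx, by simp [h2], rfl⟩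
    simp at this; omega

theorem chain_conn {G : MGraph} {C : G.E → Prop} (l : List G.E) :
    ∀ x, (x :: l).IsChain (Link G) → (∀ e ∈ l, C e) → ∀ e ∈ x :: l,
    EqvGen (fun x y => ∃ e, C e ∧ G.src e = x ∧ G.tgt e = y) (G.tgt e)
      (G.tgt ((x :: l).getLast (by simp))) := by
  induction l with
  | nil => intro x _ _ e he; simp at he; subst he; exact EqvGen.refl _
  | cons y l ih =>
    intro x hch hC e he
    rw [List.isChain_cons_cons] at hch
    have ih' := ih y hch.2 (fun e he => hC e (List.mem_cons_of_mem _ he))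
    rw [List.getLast_cons (by simp)]
    rcases List.mem_cons.1 he with rfl | he
    · refine EqvGen.trans _ _ _ (EqvGen.rel _ _ ⟨y, hC y (by simp), hch.1.1.symm, rfl⟩) ?_
      exact ih' y (by simp)
    · exact ih' e he

theorem mem_walkVerts {G : MGraph} {es : List G.E} (hne : es ≠ []) {x : G.V}
    (hx : x ∈ G.walkVerts es) : x = G.src (es.head hne) ∨ ∃ e ∈ es, G.tgt e = x := by
  cases es with
  | nil => exact absurd rfl hne
  | cons b l => simpa [MGraph.walkVerts, eq_comm] using hx

open Classical in
theorem seg_model {X H : MGraph} [Finite X.V] (hSG : IsSegmentGraph X H) :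
    ∃ M : Model X H, M.Red := by
  obtain ⟨ι, β, ιi, hβ, huniq, -, hsrc, htgt, hcyc, hfresh, hV⟩ := hSG
  have hip := fun a => (ip_iff X (β a)).1 (hβ a).1
  have hne : ∀ a, β a ≠ [] := fun a => (hip a).1
  have hseg : ∀ e : X.E, ∃ a : H.E, e ∈ β a := by
    intro e
    obtain ⟨es, h1, h2⟩ := seg_exists X e
    obtain ⟨a, ha, -⟩ := huniq es h1
    have : e ∈ ({x | x ∈ β a} : Set X.E) := by
      rw [ha]; exact h2
    exact ⟨a, this⟩
  have huni : ∀ a b : H.E, ({x | x ∈ β a} : Set X.E) = {x | x ∈ β b} → a = b := fun a b h =>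
    (huniq _ (hβ b)).unique h rfl
  have huni' : ∀ (a b : H.E) (e : X.E), e ∈ β a → e ∈ β b → a = b := by
    intro a b e ha hb
    apply huni
    ext x
    exact ⟨seg_sub (hβ a) (hβ b) ha hb x, seg_sub (hβ b) (hβ a) hb ha x⟩
  choose seg hsg using hseg
  let hd : H.E → X.E := fun a => (β a).head (hne a)
  let la : H.E → X.E := fun a => (β a).getLast (hne a)
  have hd_mem : ∀ a, hd a ∈ β a := fun a => List.head_mem _
  have la_mem : ∀ a, la a ∈ β a := fun a => List.getLast_mem _
  have seg_eq : ∀ a e, e ∈ β a → seg e = a := fun a e h => huni' _ _ e (hsg e) h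
  have first_eq : ∀ a, X.firstV (β a) = some (X.src (hd a)) := by
    intro a
    simp only [MGraph.firstV, hd, List.head?_eq_some_head (hne a), Option.map_some]
  have last_eq : ∀ a, X.lastV (β a) = some (X.tgt (la a)) := by
    intro a
    simp only [MGraph.lastV, la, List.getLast?_eq_some_getLast (hne a), Option.map_some]
  have hdl : ∀ a, X.Internal (X.src (hd a)) → X.tgt (la a) = X.src (hd a) := fun a h =>
    first_internal (hβ a).1 (hβ a).2.1 (hne a) h
  have hll : ∀ a, X.Internal (X.tgt (la a)) → X.tgt (la a) = X.src (hd a) := fun a h =>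
    last_internal (hβ a).1 (hβ a).2.2 (hne a) h
  have allint : ∀ a, X.Internal (X.src (hd a)) → ∀ x ∈ X.walkVerts (β a), X.Internal x := by
    intro a h x hx
    have hx' : x = X.src (hd a) ∨ ∃ e ∈ β a, X.tgt e = x := by
      exact mem_walkVerts (hne a) hx
    rcases hx' with rfl | ⟨e, he, rfl⟩
    · exact h
    · rcases chain_next (hip a).2.1 (hne a) he with h' | ⟨e', -, h'⟩
      · have h1 := hdl a h
        rw [h']
        show X.Internal (X.tgt (la a))
        rw [h1]; exact h
      · exact h'.2
  have cyc : ∀ a, X.Internal (X.src (hd a)) → H.src a = H.tgt a ∧ H.src a ∉ Set.range ι :=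
    fun a h => hcyc a (allint a h)
  have cyc' : ∀ a, X.Internal (X.tgt (la a)) → H.src a = H.tgt a ∧ H.src a ∉ Set.range ι :=
    fun a h => cyc a (by rw [← hll a h]; exact h)
  have srcι : ∀ a (h : X.External (X.src (hd a))), H.src a = ι ⟨_, h⟩ :=
    fun a h => hsrc a _ h (first_eq a)
  have tgtι : ∀ a (h : X.External (X.tgt (la a))), H.tgt a = ι ⟨_, h⟩ :=
    fun a h => htgt a _ h (last_eq a)
  have ext_last : ∀ e, X.External (X.tgt e) → e = la (seg e) := by
    intro e h
    rcases chain_next (hip _).2.1 (hne _) (hsg e) with h' | ⟨e', -, h'⟩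
    · exact h'
    · exact absurd h'.2 h
  have ext_first : ∀ e, X.External (X.src e) → e = hd (seg e) := by
    intro e h
    rcases chain_prev (hip _).2.1 (hne _) (hsg e) with h' | ⟨e', -, h'⟩
    · exact h'
    · exact absurd (h'.1 ▸ h'.2) h
  have hin : ∀ v, ∃ o : X.V → H.V, ∀ e, X.Internal v → X.tgt e = v → o v = H.tgt (seg e) := by
    intro v
    by_cases h : X.Internal v
    · obtain ⟨e, he, hu⟩ := h.2.1
      refine ⟨fun _ => H.tgt (seg e), fun e' _ he' => ?_⟩
      rw [hu e' he']
    · by_cases hn : Nonempty H.V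
      · exact ⟨fun _ => hn.some, fun e h' => absurd h' h⟩
      · exact absurd ⟨ι ⟨v, h⟩⟩ hn
  choose o ho using hin
  let ρ : X.V → H.V := fun v => if h : X.Internal v then o v v else ι ⟨v, h⟩
  have ρext : ∀ v (h : X.External v), ρ v = ι ⟨v, h⟩ := by
    intro v h
    have h' : ¬ X.Internal v := h
    simp only [ρ, dif_neg h']
  have ρtgt : ∀ e, ρ (X.tgt e) = H.tgt (seg e) := by
    intro e
    by_cases h : X.Internal (X.tgt e)
    · simp only [ρ, dif_pos h]
      exact ho _ e h rfl
    · rw [ρext _ h]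
      have h1 := ext_last e h
      have h2 : X.External (X.tgt (la (seg e))) := by rw [← h1]; exact h
      rw [tgtι _ h2]
      congr 2
      rw [← h1]
  have ρsrc : ∀ e, X.Internal (X.src e) → ρ (X.src e) = H.tgt (seg e) := by
    intro e h
    obtain ⟨e', he', -⟩ := h.2.1
    rw [← he', ρtgt, seg_eq (seg e) e' (seg_prev (hβ _) (hsg e) h he')]
  have hdseg : ∀ a, seg (hd a) = a := fun a => seg_eq a _ (hd_mem a)
  have laseg : ∀ a, seg (la a) = a := fun a => seg_eq a _ (la_mem a)
  have hdinj : Function.Injective hd := by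
    intro a b h
    rw [← hdseg a, h, hdseg b]
  have nonhd : ∀ e, e ∉ Set.range hd → X.Internal (X.src e) := by
    intro e he
    by_contra h
    exact he ⟨_, (ext_first e h).symm⟩
  have connl : ∀ e, EqvGen (fun x y => ∃ e, e ∉ Set.range hd ∧ X.src e = x ∧ X.tgt e = y)
      (X.tgt e) (X.tgt (la (seg e))) := by
    intro e
    have hhd : ∀ x ∈ (β (seg e)).tail, x ∉ Set.range hd := by
      rintro x hx ⟨b, rfl⟩
      have h1 : b = seg e := by
        rw [← hdseg b]
        exact seg_eq _ _ (List.mem_of_mem_tail hx)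
      rw [h1] at hx
      have h2 := (hip (seg e)).2.2.2
      have h3 : (hd (seg e) :: (β (seg e)).tail) = β (seg e) := List.cons_head_tail _
      rw [← h3] at h2
      simp only [List.map_cons, List.nodup_cons] at h2
      exact h2.1 (List.mem_map_of_mem hx)
    have h3 : (hd (seg e) :: (β (seg e)).tail) = β (seg e) := List.cons_head_tail _
    have := chain_conn (C := fun e => e ∉ Set.range hd) (β (seg e)).tail (hd (seg e))
      (by rw [h3]; exact (hip _).2.1) hhd e (by rw [h3]; exact hsg e)
    simp only [h3] at this
    exact this
  have rep : ∀ v, ∃ w, EqvGen (fun x y => ∃ e, e ∉ Set.range hd ∧ X.src e = x ∧ X.tgt e = y)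
      v w ∧ ((∃ h : X.External w, ρ v = ι ⟨w, h⟩) ∨
        ∃ a, w = X.tgt (la a) ∧ ρ v = H.tgt a ∧ H.src a = H.tgt a ∧ ρ v ∉ Set.range ι) := by
    intro v
    by_cases h : X.Internal v
    · obtain ⟨e, rfl, -⟩ := h.2.1
      refine ⟨_, connl e, ?_⟩
      by_cases h' : X.Internal (X.tgt (la (seg e)))
      · right
        have := cyc' _ h'
        refine ⟨seg e, rfl, ρtgt e, this.1, ?_⟩
        rw [ρtgt, ← this.1]; exact this.2
      · left
        exact ⟨h', by rw [ρtgt, tgtι _ h']⟩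
    · exact ⟨v, EqvGen.refl _, Or.inl ⟨h, ρext v h⟩⟩
  refine ⟨{ φ := hd, ρ := fun v => some (ρ v), inj := hdinj, hs := ?_,
            ht := ?_, hc := ?_, conn := ?_, surj := ?_ }, ?_⟩
  · intro a
    congr 1
    by_cases h : X.Internal (X.src (hd a))
    · rw [ρsrc _ h, hdseg, (cyc a h).1]
    · rw [ρext _ h, srcι a h]
  · intro a
    rw [ρtgt, hdseg]
  · intro e he
    rw [ρtgt, ρsrc _ (nonhd e he)]
  · intro u v h hu hv
    have huv : ρ u = ρ v := Option.some.inj (hu.trans hv.symm)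
    obtain ⟨w, hw, hw'⟩ := rep u
    obtain ⟨z, hz, hz'⟩ := rep v
    have : w = z := by
      rcases hw' with ⟨h1, h2⟩ | ⟨a, h1, h2, h3, h4⟩
      · rcases hz' with ⟨k1, k2⟩ | ⟨b, k1, k2, k3, k4⟩
        · have := ιi (h2.symm.trans (huv.trans k2))
          exact congrArg Subtype.val this
        · exact absurd ⟨_, (huv.symm.trans h2).symm⟩ k4
      · rcases hz' with ⟨k1, k2⟩ | ⟨b, k1, k2, k3, k4⟩
        · exact absurd ⟨_, (huv.trans k2).symm⟩ h4
        · have : a = b := by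
            apply huni
            apply hfresh
            · rw [h3, ← h2]; exact h4
            · rw [k3, ← k2]; exact k4
            · rw [h3, k3, ← h2, ← k2, huv]
          rw [h1, k1, this]
    subst this
    exact hw.trans _ _ _ hz.symm
  · intro h
    rcases hV h with ⟨⟨v, hv⟩, rfl⟩ | ⟨a, h1, h2, -⟩
    · exact ⟨v, by simp only [ρext v hv]⟩
    · exact ⟨X.tgt (hd a), by simp only [ρtgt, hdseg, h2]⟩
  · intro h
    rcases hV h with ⟨⟨v, hv⟩, rfl⟩ | ⟨a, h1, h2, -⟩
    · by_cases hvo : v ∈ X.out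
      · exact Or.inl ⟨v, hvo, by simp only [ρext v hv]⟩
      · right; left
        rintro ⟨⟨a, ha, ua⟩, ⟨b, hb, ub⟩⟩
        apply hv
        refine ⟨hvo, ⟨la a, ?_, ?_⟩, ⟨hd b, ?_, ?_⟩⟩
        · by_cases h : X.Internal (X.tgt (la a))
          · have := cyc' a h
            rw [this.1, ha] at this
            exact absurd ⟨_, rfl⟩ this.2
          · have := ιi ((tgtι a h).symm.trans ha)
            exact congrArg Subtype.val this
        · rintro e rfl
          have h1 : H.tgt (seg e) = ι ⟨X.tgt e, hv⟩ := by rw [← ρtgt, ρext _ hv]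
          rw [← ua _ h1]
          exact ext_last e hv
        · by_cases h : X.Internal (X.src (hd b))
          · have := cyc b h
            rw [hb] at this
            exact absurd ⟨_, rfl⟩ this.2
          · have := ιi ((srcι b h).symm.trans hb)
            exact congrArg Subtype.val this
        · rintro e rfl
          have h0 := ext_first e hv
          have hv' : X.External (X.src (hd (seg e))) := by rw [← h0]; exact hv
          have h1 : H.src (seg e) = ι ⟨X.src e, hv⟩ := by
            rw [srcι _ hv']
            congr 2
            rw [← h0]
          rw [← ub _ h1]
          exact h0
    · exact Or.inr (Or.inr ⟨a, h1, h2⟩)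

end SegMinor

/-- If `X` is obtained from `G` by contracting edges, deleting isolated vertices,
and subdividing edges into paths of fresh internal vertices, then the segment graph
of `X` is a minor of `G`. -/
theorem segment_graph_of_expansion_is_minor (G X H : MGraph) [Finite X.V] [Finite X.E]
    (hsteps : Relation.ReflTransGen
      (fun P Q => ContractionStepO P Q ∨ IsolatedVertexDeletionO P Q ∨ SubdivisionStep P Q)
      G X)
    (hSG : IsSegmentGraph X H) :
    IsMinorOf H G := by
  have key : Finite G.V ∧ Finite G.E ∧ ∃ M : SegMinor.Model G H, M.Red := by
    induction hsteps using Relation.ReflTransGen.head_induction_on with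
    | refl => exact ⟨inferInstance, inferInstance, SegMinor.seg_model hSG⟩
    | head hst _ ih =>
      obtain ⟨h1, h2, M, hM⟩ := ih
      obtain ⟨h3, h4⟩ := SegMinor.finite_back hst
      refine ⟨h3, h4, ?_⟩
      rcases hst with h | h | h
      · exact SegMinor.contraction_back h M hM
      · exact SegMinor.deletion_back h M hM
      · exact SegMinor.subdivision_back h M hM
  obtain ⟨h1, h2, M, -⟩ := key
  exact SegMinor.Model.minor _ G H M rfl
end

section
/- Let Γ be a UCRPQ, ξ a hom-minimal expansion of Γ, and Δ any UCRPQ equivalent to Γ. Then there is a disjunct δ of Δ such that the segment graph of the core of ξ is a minor of the underlying directed multigraph of δ. In particular, the number of segments of the core of ξ is at most the maximum number of atoms of a disjunct of Δ. -/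
/-- A graph database over alphabet `A`: an edge-labelled directed graph. -/
structure DB (A : Type) where
  V : Type
  edge : V → A → V → Prop

/-- `G.path w u v`: there is a directed path from `u` to `v` labelled by the word `w`. -/
def DB.path {A : Type} (G : DB A) : List A → G.V → G.V → Prop
  | [], u, v => u = v
  | a :: w, u, v => ∃ x, G.edge u a x ∧ DB.path G w x v

/-- A conjunctive regular path query: a finite directed multigraph whose edges (atoms)
are labelled by languages, with a tuple of output variables. -/
structure CRPQ (A : Type) (n : ℕ) where
  V : Type
  I : Type
  finV : Finite V
  finI : Finite I
  src : I → V
  tgt : I → V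
  lang : I → Set (List A)
  out : Fin n → V

/-- Satisfaction of a CRPQ on a database at an output tuple. -/
def CRPQ.sat {A : Type} {n : ℕ} (γ : CRPQ A n) (G : DB A) (t : Fin n → G.V) : Prop :=
  ∃ h : γ.V → G.V, (∀ k, h (γ.out k) = t k) ∧
    ∀ i, ∃ w ∈ γ.lang i, G.path w (h (γ.src i)) (h (γ.tgt i))

/-- A choice of expansion words: one word from each atom language. -/
def CRPQ.IsExpansionWords {A : Type} {n : ℕ} (γ : CRPQ A n) (w : γ.I → List A) : Prop :=
  ∀ i, w i ∈ γ.lang i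

/-- Satisfaction of the expansion of `γ` determined by the words `w`. -/
def CRPQ.expSat {A : Type} {n : ℕ} (γ : CRPQ A n) (w : γ.I → List A) (G : DB A)
    (t : Fin n → G.V) : Prop :=
  ∃ h : γ.V → G.V, (∀ k, h (γ.out k) = t k) ∧ ∀ i, G.path (w i) (h (γ.src i)) (h (γ.tgt i))

/-- A CQ is a CRPQ all of whose atom languages are single-letter singletons. -/
def CRPQ.IsCQ {A : Type} {n : ℕ} (η : CRPQ A n) : Prop := ∀ i, ∃ a : A, η.lang i = {[a]}

/-- Vertices of the expansion of `γ` along `w`, before identifying endpoints of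
empty-word atoms: original variables plus fresh intermediate path variables. -/
def CanonBase {A : Type} {n : ℕ} (γ : CRPQ A n) (w : γ.I → List A) : Type :=
  γ.V ⊕ (Σ i : γ.I, Fin ((w i).length - 1))

/-- The `k`-th vertex on the expansion path of atom `i`. -/
def nodeAt {A : Type} {n : ℕ} (γ : CRPQ A n) (w : γ.I → List A) (i : γ.I) (k : ℕ) :
    CanonBase γ w :=
  if h : 0 < k ∧ k < (w i).length then Sum.inr ⟨i, ⟨k - 1, by omega⟩⟩
  else if k = 0 then Sum.inl (γ.src i) else Sum.inl (γ.tgt i)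

/-- Identifications forced by empty-word atoms. -/
def canonRel {A : Type} {n : ℕ} (γ : CRPQ A n) (w : γ.I → List A) :
    CanonBase γ w → CanonBase γ w → Prop :=
  fun u v => ∃ i, w i = [] ∧ u = Sum.inl (γ.src i) ∧ v = Sum.inl (γ.tgt i)

/-- The canonical database of the expansion of `γ` along the words `w`. -/
def canonDB {A : Type} {n : ℕ} (γ : CRPQ A n) (w : γ.I → List A) : DB A where
  V := Quot (canonRel γ w)
  edge u a v := ∃ (i : γ.I) (k : ℕ) (hk : k < (w i).length),
    (w i).get ⟨k, hk⟩ = a ∧ u = Quot.mk _ (nodeAt γ w i k) ∧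
      v = Quot.mk _ (nodeAt γ w i (k + 1))

/-- The canonical output tuple of the canonical database. -/
def canonOut {A : Type} {n : ℕ} (γ : CRPQ A n) (w : γ.I → List A) :
    Fin n → (canonDB γ w).V :=
  fun k => Quot.mk (canonRel γ w) (Sum.inl (γ.out k))

/-- A labelled CQ: a finite directed multigraph with letter-labelled edges and outputs. -/
structure LCQ (A : Type) (n : ℕ) where
  V : Type
  E : Type
  finV : Finite V
  finE : Finite E
  src : E → V
  tgt : E → V
  lab : E → A
  out : Fin n → V

/-- A homomorphism of labelled CQs: preserves edges, labels and outputs pointwise. -/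
def LCQHom {A : Type} {n : ℕ} (P Q : LCQ A n) (fV : P.V → Q.V) (fE : P.E → Q.E) : Prop :=
  (∀ e, Q.src (fE e) = fV (P.src e)) ∧ (∀ e, Q.tgt (fE e) = fV (P.tgt e)) ∧
  (∀ e, Q.lab (fE e) = P.lab e) ∧ (∀ k, fV (P.out k) = Q.out k)

def LCQ.HomTo {A : Type} {n : ℕ} (P Q : LCQ A n) : Prop := ∃ fV fE, LCQHom P Q fV fE

def HomEquiv {A : Type} {n : ℕ} (P Q : LCQ A n) : Prop := P.HomTo Q ∧ Q.HomTo P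

/-- `C` is a core of `P`: hom-equivalent to `P`, and every endomorphism of `C`
is an automorphism. -/
def IsCoreOf {A : Type} {n : ℕ} (C P : LCQ A n) : Prop :=
  HomEquiv C P ∧
    ∀ fV fE, LCQHom C C fV fE → Function.Bijective fV ∧ Function.Bijective fE

/-- The expansion of `γ` along the words `w`, as a labelled CQ. -/
def expLCQ {A : Type} {n : ℕ} (γ : CRPQ A n) (w : γ.I → List A) : LCQ A n where
  V := Quot (canonRel γ w)
  E := Σ i : γ.I, Fin ((w i).length)
  finV := by
    haveI := γ.finV; haveI := γ.finI
    haveI : Finite (CanonBase γ w) := by unfold CanonBase; infer_instance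
    exact Finite.of_surjective (Quot.mk (canonRel γ w))
      (fun q => Quot.inductionOn q fun a => ⟨a, rfl⟩)
  finE := by haveI := γ.finI; infer_instance
  src e := Quot.mk _ (nodeAt γ w e.1 e.2.1)
  tgt e := Quot.mk _ (nodeAt γ w e.1 (e.2.1 + 1))
  lab e := (w e.1).get e.2
  out k := Quot.mk _ (Sum.inl (γ.out k))

/-- The underlying multigraph of a labelled CQ. -/
def LCQ.toMGraph {A : Type} {n : ℕ} (P : LCQ A n) : MGraph :=
  ⟨P.V, P.E, P.src, P.tgt, Set.range P.out⟩

/-- The underlying multigraph of a CRPQ. -/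
def CRPQ.toMGraph {A : Type} {n : ℕ} (γ : CRPQ A n) : MGraph :=
  ⟨γ.V, γ.I, γ.src, γ.tgt, Set.range γ.out⟩

/-- The maximum number of atoms of a disjunct of a union of CRPQs. -/
noncomputable def maxAtoms {A : Type} {n : ℕ} (Γ : List (CRPQ A n)) : ℕ :=
  (Γ.map fun γ => Nat.card γ.I).foldr max 0


/-! ### Minor models -/

/-- A minor model of `H` in `G`. -/
def MinorModel (G H : MGraph) : Prop :=
  ∃ (p : G.V → Option H.V) (T : Set G.E) (j : H.E → G.E),
    Function.Injective j ∧
    (∀ a : H.V, ∃ u, p u = some a) ∧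
    (∀ e, p (G.src (j e)) = some (H.src e)) ∧
    (∀ e, p (G.tgt (j e)) = some (H.tgt e)) ∧
    (∀ e, j e ∉ T) ∧
    (∀ x ∈ T, p (G.src x) = p (G.tgt x)) ∧
    (∀ U : Set G.V, (∀ x ∈ T, (G.src x ∈ U ↔ G.tgt x ∈ U)) →
      ∀ u v a, p u = some a → p v = some a → u ∈ U → v ∈ U)

theorem MinorModel.vertexDeletion {G H : MGraph} {p : G.V → Option H.V} {T : Set G.E}
    {j : H.E → G.E} (hj : Function.Injective j)
    (hs : ∀ a : H.V, ∃ u, p u = some a)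
    (h1 : ∀ e, p (G.src (j e)) = some (H.src e))
    (h2 : ∀ e, p (G.tgt (j e)) = some (H.tgt e))
    (h3 : ∀ e, j e ∉ T)
    (h4 : ∀ x ∈ T, p (G.src x) = p (G.tgt x))
    (h5 : ∀ U : Set G.V, (∀ x ∈ T, (G.src x ∈ U ↔ G.tgt x ∈ U)) →
      ∀ u v a, p u = some a → p v = some a → u ∈ U → v ∈ U)
    (v₀ : G.V) (hv : p v₀ = none) :
    MinorModel ⟨{v : G.V // v ≠ v₀}, {e : G.E // G.src e ≠ v₀ ∧ G.tgt e ≠ v₀},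
      fun e => ⟨G.src e.1, e.2.1⟩, fun e => ⟨G.tgt e.1, e.2.2⟩, ∅⟩ H := by
  have hne : ∀ u a, p u = some a → u ≠ v₀ := by
    rintro u a h rfl
    rw [hv] at h; cases h
  refine ⟨fun v => p v.1, {x | x.1 ∈ T},
    fun e => ⟨j e, hne _ _ (h1 e), hne _ _ (h2 e)⟩, ?_, ?_, h1, h2, h3, ?_, ?_⟩
  · intro a b h
    exact hj (congrArg Subtype.val h)
  · intro a
    obtain ⟨u, hu⟩ := hs a
    exact ⟨⟨u, hne _ _ hu⟩, hu⟩
  · intro x hx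
    exact h4 x.1 hx
  · intro U hU u v a hu hv' huU
    have key := h5 {y | (∃ h : y ≠ v₀, (⟨y, h⟩ : {v : G.V // v ≠ v₀}) ∈ U) ∧ p y = some a} ?_
      u.1 v.1 a hu hv' ⟨⟨u.2, huU⟩, hu⟩
    · exact key.1.2
    · intro x hx
      have e4 := h4 x hx
      constructor
      · rintro ⟨⟨h, hxU⟩, hp⟩
        have hp' : p (G.tgt x) = some a := e4 ▸ hp
        refine ⟨⟨hne _ _ hp', ?_⟩, hp'⟩
        exact (hU ⟨x, h, hne _ _ hp'⟩ hx).1 hxU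
      · rintro ⟨⟨h, hxU⟩, hp⟩
        have hp' : p (G.src x) = some a := e4.trans hp
        refine ⟨⟨hne _ _ hp', ?_⟩, hp'⟩
        exact (hU ⟨x, hne _ _ hp', h⟩ hx).2 hxU

/-- The setoid identifying two vertices. -/
def pairSetoid {V : Type} (a b : V) : Setoid V where
  r u v := u = v ∨ (u = a ∧ v = b) ∨ (u = b ∧ v = a)
  iseqv := by
    refine ⟨fun _ => Or.inl rfl, ?_, ?_⟩
    · rintro x y (h | h | h)
      · exact Or.inl h.symm
      · exact Or.inr (Or.inr ⟨h.2, h.1⟩)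
      · exact Or.inr (Or.inl ⟨h.2, h.1⟩)
    · rintro x y z (rfl | ⟨rfl, rfl⟩ | ⟨rfl, rfl⟩) (rfl | ⟨h, rfl⟩ | ⟨h, rfl⟩) <;> simp_all

theorem MinorModel.contraction {G H : MGraph} {p : G.V → Option H.V} {T : Set G.E}
    {j : H.E → G.E} (hj : Function.Injective j)
    (hs : ∀ a : H.V, ∃ u, p u = some a)
    (h1 : ∀ e, p (G.src (j e)) = some (H.src e))
    (h2 : ∀ e, p (G.tgt (j e)) = some (H.tgt e))
    (h3 : ∀ e, j e ∉ T)
    (h4 : ∀ x ∈ T, p (G.src x) = p (G.tgt x))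
    (h5 : ∀ U : Set G.V, (∀ x ∈ T, (G.src x ∈ U ↔ G.tgt x ∈ U)) →
      ∀ u v a, p u = some a → p v = some a → u ∈ U → v ∈ U)
    (e₀ : G.E) (he : e₀ ∈ T) :
    MinorModel ⟨Quotient (pairSetoid (G.src e₀) (G.tgt e₀)), {e : G.E // e ≠ e₀},
      fun e => Quotient.mk _ (G.src e.1), fun e => Quotient.mk _ (G.tgt e.1), ∅⟩ H := by
  refine ⟨Quotient.lift p ?_, {x | x.1 ∈ T},
    fun e => ⟨j e, fun h => h3 e (h ▸ he)⟩, ?_, ?_, h1, h2, h3, ?_, ?_⟩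
  · rintro a b (rfl | ⟨rfl, rfl⟩ | ⟨rfl, rfl⟩)
    · rfl
    · exact h4 e₀ he
    · exact (h4 e₀ he).symm
  · intro a b h
    exact hj (congrArg Subtype.val h)
  · intro a
    obtain ⟨u, hu⟩ := hs a
    exact ⟨Quotient.mk _ u, hu⟩
  · intro x hx
    exact h4 x.1 hx
  · intro U hU u v a
    induction u using Quotient.inductionOn with | _ u =>
    induction v using Quotient.inductionOn with | _ v =>
    intro hu hv huU
    refine h5 {y | (Quotient.mk (pairSetoid (G.src e₀) (G.tgt e₀)) y) ∈ U} ?_ u v a hu hv huU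
    intro x hx
    by_cases hxe : x = e₀
    · subst hxe
      have : Quotient.mk (pairSetoid (G.src x) (G.tgt x)) (G.src x)
          = Quotient.mk (pairSetoid (G.src x) (G.tgt x)) (G.tgt x) :=
        Quotient.sound (Or.inr (Or.inl ⟨rfl, rfl⟩))
      simp only [Set.mem_ofPred_eq]
      rw [this]
    · exact hU ⟨x, hxe⟩ hx

theorem MinorModel.isMinorOf_aux (m : ℕ) : ∀ (G H : MGraph), Finite G.V → Finite G.E →
    Nat.card G.V + Nat.card G.E = m → MinorModel G H → IsMinorOf H G := by
  induction m using Nat.strong_induction_on with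
  | _ m ih =>
  rintro G H fV fE rfl ⟨p, T, j, hj, hs, h1, h2, h3, h4, h5⟩
  by_cases c1 : ∃ v₀, p v₀ = none
  · obtain ⟨v₀, hv⟩ := c1
    have M := MinorModel.vertexDeletion hj hs h1 h2 h3 h4 h5 v₀ hv
    have hlt : Nat.card {v : G.V // v ≠ v₀} < Nat.card G.V :=
      Finite.card_subtype_lt (x := v₀) (by simp)
    have hle : Nat.card {e : G.E // G.src e ≠ v₀ ∧ G.tgt e ≠ v₀} ≤ Nat.card G.E :=
      Finite.card_subtype_le _
    refine Relation.ReflTransGen.head ?_ (ih _ ?_ _ H ?_ ?_ rfl M)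
    · refine Or.inr (Or.inr (Or.inl ⟨v₀, id, id, Function.bijective_id,
        Function.bijective_id, fun _ => rfl, fun _ => rfl⟩))
    · dsimp only; omega
    · dsimp only; infer_instance
    · dsimp only; infer_instance
  by_cases c2 : ∃ e₀, e₀ ∈ T
  · obtain ⟨e₀, he⟩ := c2
    have M := MinorModel.contraction hj hs h1 h2 h3 h4 h5 e₀ he
    have hlt : Nat.card {v : G.E // v ≠ e₀} < Nat.card G.E :=
      Finite.card_subtype_lt (x := e₀) (by simp)
    have hle : Nat.card (Quotient (pairSetoid (G.src e₀) (G.tgt e₀))) ≤ Nat.card G.V :=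
      Nat.card_le_card_of_surjective _ Quotient.mk_surjective
    refine Relation.ReflTransGen.head ?_ (ih _ ?_ _ H ?_ ?_ rfl M)
    · refine Or.inr (Or.inr (Or.inr ⟨e₀, Quotient.mk _, id, Quotient.mk_surjective,
        Function.bijective_id, ?_, fun _ => rfl, fun _ => rfl⟩))
      intro u v
      exact Quotient.eq (r := pairSetoid (G.src e₀) (G.tgt e₀))
    · dsimp only; omega
    · dsimp only; infer_instance
    · dsimp only; infer_instance
  have hT : ∀ x, x ∉ T := fun x hx => c2 ⟨x, hx⟩
  by_cases c3 : ∃ e₀, ∀ e, j e ≠ e₀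
  · obtain ⟨e₀, he⟩ := c3
    have hlt : Nat.card {v : G.E // v ≠ e₀} < Nat.card G.E :=
      Finite.card_subtype_lt (x := e₀) (by simp)
    have M : MinorModel ⟨G.V, {e : G.E // e ≠ e₀}, fun e => G.src e.1,
        fun e => G.tgt e.1, ∅⟩ H := by
      refine ⟨p, ∅, fun e => ⟨j e, he e⟩, ?_, hs, h1, h2, fun _ h => h, ?_, ?_⟩
      · intro a b h
        exact hj (congrArg Subtype.val h)
      · intro x hx; exact hx.elim
      · intro U _
        exact h5 U (fun x hx => (hT x hx).elim)
    refine Relation.ReflTransGen.head ?_ (ih _ ?_ _ H ?_ ?_ rfl M)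
    · refine Or.inr (Or.inl ⟨e₀, id, id, Function.bijective_id,
        Function.bijective_id, fun _ => rfl, fun _ => rfl⟩)
    · dsimp only; omega
    · dsimp only; infer_instance
    · dsimp only; infer_instance
  have hjs : Function.Surjective j := by
    intro e
    by_contra hcon
    exact c3 ⟨e, fun x hx => hcon ⟨x, hx⟩⟩
  have hsome : ∀ v, ∃ a, p v = some a := by
    intro v
    cases hpv : p v with
    | none => exact (c1 ⟨v, hpv⟩).elim
    | some a => exact ⟨a, rfl⟩
  choose f hf using hsome
  obtain ⟨k, hk1, hk2⟩ := Function.bijective_iff_has_inverse.1 ⟨hj, hjs⟩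
  refine Relation.ReflTransGen.single (Or.inl ⟨f, k, ⟨?_, ?_⟩, ⟨hk2.injective, hk1.surjective⟩,
    ?_, ?_⟩)
  · intro u v huv
    exact (h5 {u} (fun x hx => (hT x hx).elim) u v (f v) (huv ▸ hf u) (hf v) rfl).symm
  · intro a
    obtain ⟨u, hu⟩ := hs a
    exact ⟨u, Option.some.inj ((hf u).symm.trans hu)⟩
  · intro e
    have := h1 (k e)
    rw [hk2 e, hf] at this
    exact (Option.some.inj this).symm
  · intro e
    have := h2 (k e)
    rw [hk2 e, hf] at this
    exact (Option.some.inj this).symm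

theorem MinorModel.isMinorOf {G H : MGraph} (fV : Finite G.V) (fE : Finite G.E)
    (h : MinorModel G H) : IsMinorOf H G :=
  MinorModel.isMinorOf_aux _ G H fV fE rfl h

theorem MinorStep.card_le {G H : MGraph} (h : MinorStep G H) (fE : Finite G.E) :
    Finite H.E ∧ Nat.card H.E ≤ Nat.card G.E := by
  have sub : ∀ (q : G.E → Prop) (g : {e // q e} → H.E), Function.Bijective g →
      Finite H.E ∧ Nat.card H.E ≤ Nat.card G.E := by
    intro q g hg
    refine ⟨Finite.of_surjective g hg.2, ?_⟩
    rw [← Nat.card_eq_of_bijective g hg]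
    exact Finite.card_subtype_le _
  rcases h with ⟨f, g, _, hg, _⟩ | ⟨e, f, g, _, hg, _⟩ | ⟨e, f, g, _, hg, _⟩ |
    ⟨e, f, g, _, hg, _⟩
  · exact ⟨Finite.of_surjective g hg.2, (Nat.card_eq_of_bijective g hg).ge⟩
  · exact sub _ g hg
  · exact sub _ g hg
  · exact sub _ g hg

theorem IsMinorOf.card_le {G H : MGraph} (h : IsMinorOf H G) (fE : Finite G.E) :
    Finite H.E ∧ Nat.card H.E ≤ Nat.card G.E := by
  induction h with
  | refl => exact ⟨fE, le_rfl⟩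
  | tail _ hs ih =>
    obtain ⟨f, hle⟩ := ih
    obtain ⟨f', hle'⟩ := hs.card_le f
    exact ⟨f', hle'.trans hle⟩

theorem segCount_le {G H : MGraph} (h : IsSegmentGraph G H) (fE : Finite H.E) :
    segCount G ≤ Nat.card H.E := by
  obtain ⟨i, β, -, hseg, hu, -⟩ := h
  have : {S : Set G.E | ∃ es, G.IsSegment es ∧ S = {e | e ∈ es}}
      = Set.range (fun e => ({x | x ∈ β e} : Set G.E)) := by
    ext S
    constructor
    · rintro ⟨es, hes, rfl⟩
      obtain ⟨e, he, -⟩ := hu es hes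
      exact ⟨e, he⟩
    · rintro ⟨e, rfl⟩
      exact ⟨β e, hseg e, rfl⟩
  unfold segCount
  rw [this, ← Set.image_univ, ← Set.ncard_univ]
  exact Set.ncard_image_le Set.finite_univ

theorem card_le_maxAtoms {A : Type} {n : ℕ} (Δ : List (CRPQ A n)) (δ : CRPQ A n)
    (h : δ ∈ Δ) : Nat.card δ.I ≤ maxAtoms Δ := by
  unfold maxAtoms
  induction Δ with
  | nil => cases h
  | cons x l ih =>
    rcases List.mem_cons.1 h with rfl | h
    · simp
    · simp only [List.map_cons, List.foldr_cons]
      exact (ih h).trans (le_max_right _ _)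

/-! ### Segments -/

namespace MGraph

theorem IsWalk.isChain {G : MGraph} : ∀ {es : List G.E},
    G.IsWalk es ↔ es.IsChain (fun a b => G.tgt a = G.src b)
  | [] => by simp [IsWalk]
  | [_] => by simp [IsWalk]
  | e₁ :: e₂ :: es => by
    rw [IsWalk, List.isChain_cons_cons, IsWalk.isChain (es := e₂ :: es)]

theorem walkVerts_dropLast {G : MGraph} : ∀ {es : List G.E},
    G.IsWalk es → (G.walkVerts es).dropLast = es.map G.src
  | [], _ => by simp [walkVerts]
  | [_], _ => by simp [walkVerts]
  | e₁ :: e₂ :: es, h => by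
    have := walkVerts_dropLast (es := e₂ :: es) h.2
    simp only [walkVerts, List.map_cons, List.dropLast_cons_cons] at this ⊢
    rw [h.1, this]

theorem walkVerts_tail {G : MGraph} (es : List G.E) :
    (G.walkVerts es).tail = es.map G.tgt := by
  cases es <;> simp [walkVerts]

theorem isInternalPath_iff {G : MGraph} (es : List G.E) :
    G.IsInternalPath es ↔ es ≠ [] ∧ es.IsChain (fun a b => G.tgt a = G.src b) ∧
      (∀ x ∈ es.dropLast, G.Internal (G.tgt x)) ∧
      (es.map G.tgt).Nodup ∧ (es.map G.src).Nodup := by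
  unfold IsInternalPath
  rw [walkVerts_tail]
  constructor
  · rintro ⟨h1, h2, h3, h4, h5⟩
    rw [walkVerts_dropLast h2] at h5
    refine ⟨h1, IsWalk.isChain.1 h2, ?_, h4, h5⟩
    intro x hx
    apply h3
    rw [← List.map_dropLast]
    exact List.mem_map_of_mem hx
  · rintro ⟨h1, h2, h3, h4, h5⟩
    have h2' := IsWalk.isChain.2 h2
    refine ⟨h1, h2', ?_, h4, by rwa [walkVerts_dropLast h2']⟩
    intro v hv
    rw [← List.map_dropLast] at hv
    obtain ⟨x, hx, rfl⟩ := List.mem_map.1 hv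
    exact h3 x hx

theorem Internal.tgt_inj {G : MGraph} {x y : G.E} (h : G.Internal (G.tgt x))
    (he : G.tgt y = G.tgt x) : y = x := h.2.1.unique he rfl

theorem Internal.src_inj {G : MGraph} {x y : G.E} (h : G.Internal (G.src x))
    (he : G.src y = G.src x) : y = x := h.2.2.unique he rfl

/-- Splitting an internal path at a member: the successor. -/
theorem IsSegment.succ_mem {G : MGraph} {es : List G.E} (h : G.IsSegment es) {x y : G.E}
    (hx : x ∈ es) (hxy : G.tgt x = G.src y) (hi : G.Internal (G.src y)) : y ∈ es := by
  obtain ⟨hp, -, hmax⟩ := h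
  have hp' := hp
  rw [isInternalPath_iff] at hp'
  obtain ⟨h1, h2, h3, h4, h5⟩ := hp'
  obtain ⟨l₁, l₂, rfl⟩ := List.append_of_mem hx
  cases l₂ with
  | cons z l₂ =>
    have hz : G.tgt x = G.src z := by
      have := h2.right_of_append
      exact (List.isChain_cons_cons.1 this).1
    have : z = y := hi.src_inj (by rw [← hz, hxy])
    subst this
    simp
  | nil =>
    by_contra hy
    apply hmax y
    rw [isInternalPath_iff]
    refine ⟨by simp, ?_, ?_, ?_, ?_⟩
    · rw [List.isChain_append]
      refine ⟨h2, by simp, ?_⟩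
      simp [hxy]
    · intro z hz
      rw [List.dropLast_concat] at hz
      rcases List.mem_append.1 hz with hz | hz
      · exact h3 z (by simpa using hz)
      · rw [List.mem_singleton.1 hz, hxy]; exact hi
    · rw [List.map_append, List.nodup_append']
      refine ⟨h4, by simp, ?_⟩
      intro v hv hv'
      obtain ⟨z, hz, rfl⟩ := List.mem_map.1 hv
      have hzy : G.tgt z = G.tgt y := by simpa using hv'
      rcases List.mem_append.1 hz with hz' | hz'
      · have : y = z := (h3 z (by simpa using hz')).tgt_inj hzy.symm
        exact hy (this ▸ hz)
      · rw [List.mem_singleton.1 hz'] at hzy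
        have : y = x := Internal.tgt_inj (by rw [hxy]; exact hi) hzy.symm
        exact hy (this ▸ hx)
    · rw [List.map_append, List.nodup_append']
      refine ⟨h5, by simp, ?_⟩
      intro v hv hv'
      obtain ⟨z, hz, rfl⟩ := List.mem_map.1 hv
      have hzy : G.src z = G.src y := by simpa using hv'
      have : z = y := hi.src_inj hzy
      exact hy (this ▸ hz)

theorem IsSegment.pred_mem {G : MGraph} {es : List G.E} (h : G.IsSegment es) {x y : G.E}
    (hy : y ∈ es) (hxy : G.tgt x = G.src y) (hi : G.Internal (G.src y)) : x ∈ es := by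
  obtain ⟨hp, hmax, -⟩ := h
  have hp' := hp
  rw [isInternalPath_iff] at hp'
  obtain ⟨h1, h2, h3, h4, h5⟩ := hp'
  obtain ⟨l₁, l₂, rfl⟩ := List.append_of_mem hy
  have hix : G.Internal (G.tgt x) := hxy ▸ hi
  rcases List.eq_nil_or_concat l₁ with rfl | ⟨l₁, z, rfl⟩
  · by_contra hx
    apply hmax x
    rw [isInternalPath_iff]
    refine ⟨by simp, ?_, ?_, ?_, ?_⟩
    · rw [List.nil_append, List.isChain_cons_cons]
      exact ⟨hxy, h2⟩
    · intro z hz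
      rw [List.nil_append, List.dropLast_cons_cons] at hz
      rcases List.mem_cons.1 hz with rfl | hz
      · exact hix
      · exact h3 z hz
    · rw [List.map_cons, List.nodup_cons]
      refine ⟨?_, h4⟩
      intro hv
      obtain ⟨z, hz, hzx⟩ := List.mem_map.1 hv
      have : z = x := hix.tgt_inj hzx
      exact hx (this ▸ hz)
    · rw [List.map_cons, List.nodup_cons]
      refine ⟨?_, h5⟩
      intro hv
      obtain ⟨z, hz, hzx⟩ := List.mem_map.1 hv
      rcases List.mem_cons.1 hz with rfl | hz'
      · have : x = z := hi.src_inj hzx.symm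
        exact hx (this ▸ hz)
      · obtain ⟨m₁, m₂, rfl⟩ := List.append_of_mem hz'
        have : ∃ q ∈ (y :: (m₁ ++ z :: m₂)).dropLast, G.tgt q = G.src z := by
          have e1 : y :: (m₁ ++ z :: m₂) = (y :: m₁) ++ z :: m₂ := by simp
          obtain ⟨a, b, hab⟩ : ∃ a b, y :: m₁ = a ++ [b] := by
            rcases List.eq_nil_or_concat (y :: m₁) with h | ⟨a, b, h⟩
            · cases h
            · exact ⟨a, b, by simpa using h⟩
          refine ⟨b, ?_, ?_⟩
          · rw [e1, List.dropLast_append_of_ne_nil (by simp), hab]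
            simp
          · rw [List.nil_append, e1, hab, List.append_assoc] at h2
            have hk := h2.right_of_append
            simp only [List.singleton_append, List.isChain_cons_cons] at hk
            exact hk.1
        obtain ⟨q, hq, hqz⟩ := this
        have hiz : G.Internal (G.src z) := hqz ▸ h3 q hq
        have : x = z := hiz.src_inj hzx.symm
        exact hx (this ▸ hz)
  · have hz : G.tgt z = G.src y := by
      rw [List.concat_eq_append, List.append_assoc] at h2
      have hk := h2.right_of_append
      simp only [List.singleton_append, List.isChain_cons_cons] at hk
      exact hk.1
    have : z = x := hix.tgt_inj (by rw [hz, hxy])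
    subst this
    simp

/-- A member of an internal path with a non-head position has internal source. -/
theorem IsInternalPath.tail_internal {G : MGraph} {h : G.E} {l : List G.E}
    (hp : G.IsInternalPath (h :: l)) : ∀ x ∈ l, G.Internal (G.src x) := by
  rw [isInternalPath_iff] at hp
  obtain ⟨-, h2, h3, -, -⟩ := hp
  induction l generalizing h with
  | nil => simp
  | cons y l ih =>
    rw [List.isChain_cons_cons] at h2
    intro x hx
    rcases List.mem_cons.1 hx with rfl | hx
    · rw [← h2.1]
      exact h3 h (by simp)
    · refine ih h2.2 ?_ x hx
      intro z hz
      exact h3 z (by rw [List.dropLast_cons_cons]; exact List.mem_cons_of_mem _ hz)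

/-- A property that propagates along internal junctions holds on the whole path. -/
theorem IsInternalPath.propagate {G : MGraph} {es : List G.E} (hp : G.IsInternalPath es)
    (P : G.E → Prop)
    (hP : ∀ x, ∀ y ∈ es.tail, G.tgt x = G.src y → G.Internal (G.src y) → (P x ↔ P y)) :
    ∀ x ∈ es, ∀ y ∈ es, P x → P y := by
  have key : ∀ (l : List G.E) (h : G.E), (h :: l).IsChain (fun a b => G.tgt a = G.src b) →
      (∀ x ∈ l, G.Internal (G.src x)) →
      (∀ x, ∀ y ∈ l, G.tgt x = G.src y → G.Internal (G.src y) → (P x ↔ P y)) →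
      ∀ x ∈ l, (P h ↔ P x) := by
    intro l
    induction l with
    | nil => simp
    | cons y l ih =>
      intro h hc hi hQ x hx
      rw [List.isChain_cons_cons] at hc
      have e := hQ h y (by simp) hc.1 (hi y (by simp))
      rcases List.mem_cons.1 hx with rfl | hx
      · exact e
      · exact e.trans (ih y hc.2 (fun z hz => hi z (by simp [hz]))
          (fun a b hb => hQ a b (by simp [hb])) x hx)
  cases es with
  | nil => simp
  | cons h l =>
    have hi := hp.tail_internal
    have hc := ((isInternalPath_iff _).1 hp).2.1
    have k : ∀ x ∈ h :: l, (P h ↔ P x) := by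
      intro x hx
      rcases List.mem_cons.1 hx with rfl | hx
      · rfl
      · exact key l h hc hi hP x hx
    intro x hx y hy hxP
    exact (k y hy).1 ((k x hx).2 hxP)

theorem IsSegment.mem_of_mem {G : MGraph} {es es' : List G.E} (h : G.IsSegment es)
    (h' : G.IsSegment es') {x : G.E} (hx : x ∈ es) (hx' : x ∈ es') :
    ∀ y ∈ es, y ∈ es' := by
  intro y hy
  exact h.1.propagate (fun z => z ∈ es')
    (fun a b _ hab hi => ⟨fun ha => h'.succ_mem ha hab hi, fun hb => h'.pred_mem hb hab hi⟩)
    x hx y hy hx'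

theorem IsInternalPath.map_src_tail {G : MGraph} {es : List G.E} (hp : G.IsInternalPath es) :
    es.tail.map G.src = es.dropLast.map G.tgt := by
  rw [List.map_tail, List.map_dropLast, ← walkVerts_dropLast hp.2.1, ← walkVerts_tail,
    List.tail_dropLast]

theorem exists_segment {G : MGraph} (fE : Finite G.E) (x : G.E) :
    ∃ es, G.IsSegment es ∧ x ∈ es := by
  have bound : ∀ es, G.IsInternalPath es → es.length ≤ Nat.card G.E := by
    intro es hes
    have hn : es.Nodup := ((isInternalPath_iff _).1 hes).2.2.2.1.of_map _
    have := Fintype.ofFinite G.E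
    rw [Nat.card_eq_fintype_card]
    exact hn.length_le_card
  have hex : ∃ k, ∃ es, G.IsInternalPath es ∧ x ∈ es ∧ Nat.card G.E - es.length = k :=
    ⟨_, [x], by rw [isInternalPath_iff]; simp, by simp, rfl⟩
  classical
  obtain ⟨es, h1, h2, h3⟩ := Nat.find_spec hex
  refine ⟨es, ⟨h1, ?_, ?_⟩, h2⟩
  · intro e he
    have hb := bound _ he
    refine Nat.find_min hex (m := Nat.card G.E - (e :: es).length) ?_
      ⟨_, he, List.mem_cons_of_mem _ h2, rfl⟩
    rw [← h3]; simp at hb ⊢; omega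
  · intro e he
    have hb := bound _ he
    refine Nat.find_min hex (m := Nat.card G.E - (es ++ [e]).length) ?_
      ⟨_, he, List.mem_append_left _ h2, rfl⟩
    rw [← h3]; simp at hb ⊢; omega

end MGraph

/-- Abstract consequence of being a segment graph: a total model of `H` in `G` together with
the assignment of segments to edges. -/
theorem IsSegmentGraph.model {G H : MGraph} (fE : Finite G.E) (hH : IsSegmentGraph G H) :
    ∃ (q : G.V → H.V) (s : G.E → H.E) (z : H.E → G.E),
      (∀ e, s (z e) = e) ∧
      (∀ x y, G.tgt x = G.src y → G.Internal (G.src y) → s x = s y) ∧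
      (∀ e, q (G.src (z e)) = H.src e) ∧
      (∀ e, q (G.tgt (z e)) = H.tgt e) ∧
      (∀ x, (∀ e, z e ≠ x) → q (G.src x) = q (G.tgt x)) ∧
      (∀ a : H.V, (∃ e, H.tgt e = a) ∨ ∃ c, G.External c ∧ q c = a) ∧
      (∀ U : Set G.V, (∀ x, (∀ e, z e ≠ x) → (G.src x ∈ U ↔ G.tgt x ∈ U)) →
        ∀ u v, q u = q v → u ∈ U → v ∈ U) := by
  classical
  obtain ⟨ι, β, hι, hseg, huniq, hfi, hsrc, htgt, hcyc, hfresh, hV⟩ := hH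
  have hs : ∀ x, ∃ e, x ∈ β e := by
    intro x
    obtain ⟨es, h1, h2⟩ := MGraph.exists_segment fE x
    obtain ⟨e, he, -⟩ := huniq es h1
    refine ⟨e, ?_⟩
    have : x ∈ ({x | x ∈ β e} : Set G.E) := he ▸ h2
    exact this
  have heq : ∀ e e', ({x | x ∈ β e} : Set G.E) = {x | x ∈ β e'} → e = e' := by
    intro e e' h
    exact (huniq (β e') (hseg e')).unique h rfl
  have hsu : ∀ x e e', x ∈ β e → x ∈ β e' → e = e' := by
    intro x e e' h h'
    apply heq
    ext y
    exact ⟨fun hy => (hseg e).mem_of_mem (hseg e') h h' y hy,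
      fun hy => (hseg e').mem_of_mem (hseg e) h' h y hy⟩
  choose s hs using hs
  have hcons : ∀ e, ∃ z l, β e = z :: l := by
    intro e
    have := (hseg e).1.1
    cases hb : β e with
    | nil => exact (this hb).elim
    | cons z l => exact ⟨z, l, rfl⟩
  choose z l hzl using hcons
  have hz : ∀ e, z e ∈ β e := fun e => by rw [hzl]; simp
  have hsz : ∀ e, s (z e) = e := fun e => hsu _ _ _ (hs _) (hz e)
  have hs' : ∀ x e, x ∈ β e → s x = e := fun x e h => hsu _ _ _ (hs _) h
  have hadj : ∀ x y, G.tgt x = G.src y → G.Internal (G.src y) → s x = s y := by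
    intro x y hxy hi
    exact (hs' y _ ((hseg _).succ_mem (hs x) hxy hi)).symm
  have hfirst : ∀ e, G.firstV (β e) = some (G.src (z e)) := by
    intro e; rw [hzl]; rfl
  -- edges with external source are heads
  have hext : ∀ x, G.External (G.src x) → z (s x) = x := by
    intro x hx
    have hm := hs x
    rw [hzl] at hm
    rcases List.mem_cons.1 hm with h | h
    · exact h.symm
    · have hp := (hseg (s x)).1
      rw [hzl] at hp
      exact (hx (hp.tail_internal x h)).elim
  -- edges with external targets are last
  have hlast : ∀ x, G.External (G.tgt x) → G.lastV (β (s x)) = some (G.tgt x) := by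
    intro x hx
    have hm := hs x
    have hp := ((MGraph.isInternalPath_iff _).1 (hseg (s x)).1).2.2.1
    rcases List.eq_nil_or_concat (β (s x)) with h | ⟨a, b, h⟩
    · rw [h] at hm; cases hm
    · rw [List.concat_eq_append] at h
      rw [h] at hm hp
      rw [h]
      rcases List.mem_append.1 hm with h' | h'
      · exact (hx (hp x (by simpa using h'))).elim
      · rw [List.mem_singleton.1 h']
        simp [MGraph.lastV]
  -- the last edge
  have hla : ∀ e, ∃ y ∈ β e, G.lastV (β e) = some (G.tgt y) := by
    intro e
    rcases List.eq_nil_or_concat (β e) with h | ⟨a, b, h⟩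
    · rw [hzl] at h; cases h
    · exact ⟨b, by rw [h]; simp, by rw [h]; simp [MGraph.lastV]⟩
  -- dichotomy for segments
  have hdich : ∀ e, (∃ y, s y = e ∧ ∃ h : G.External (G.tgt y), H.tgt e = ι ⟨G.tgt y, h⟩) ∨
      (H.src e = H.tgt e ∧ H.src e ∉ Set.range ι) := by
    intro e
    by_cases hfe : G.Internal (G.src (z e))
    · exact Or.inr (hcyc e (hfi e _ (hfirst e) hfe))
    · left
      obtain ⟨y, hy, hyl⟩ := hla e
      rcases List.eq_nil_or_concat (β e) with h | ⟨a, b, h⟩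
      · rw [hzl] at h; cases h
      rw [List.concat_eq_append] at h
      have hb : b ∈ β e := by rw [h]; simp
      have hbl : G.lastV (β e) = some (G.tgt b) := by rw [h]; simp [MGraph.lastV]
      have hbe : G.External (G.tgt b) := by
        intro hbi
        obtain ⟨v, hv⟩ := hbi.2.2.exists
        have hvi : G.Internal (G.src v) := hv ▸ hbi
        have hvm := (hseg e).succ_mem hb hv.symm hvi
        have hvt : v ∈ (β e).tail := by
          rw [hzl] at hvm ⊢
          rcases List.mem_cons.1 hvm with h' | h'
          · subst h'; exact (hfe hvi).elim
          · exact h'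
        have hm : G.src v ∈ (β e).dropLast.map G.tgt := by
          rw [← (hseg e).1.map_src_tail]
          exact List.mem_map_of_mem hvt
        have hnd := ((MGraph.isInternalPath_iff _).1 (hseg e).1).2.2.2.1
        rw [h, List.dropLast_concat, hv] at hm
        rw [h, List.map_append, List.nodup_append'] at hnd
        exact hnd.2.2 hm (by simp)
      exact ⟨b, hs' b e hb, hbe, htgt e _ hbe hbl⟩
  have hq : ∀ c, ∃ a, (∀ h : G.External c, a = ι ⟨c, h⟩) ∧
      (∀ y, G.Internal c → G.src y = c → a = H.tgt (s y)) := by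
    intro c
    by_cases hc : G.Internal c
    · obtain ⟨y, hy⟩ := hc.2.2.exists
      refine ⟨H.tgt (s y), fun h => (h hc).elim, fun y' _ hy' => ?_⟩
      rw [hc.2.2.unique hy hy']
    · exact ⟨ι ⟨c, hc⟩, fun _ => rfl, fun _ h => (hc h).elim⟩
  choose q hqe hqi using hq
  have qt : ∀ x, q (G.tgt x) = H.tgt (s x) := by
    intro x
    by_cases hx : G.Internal (G.tgt x)
    · obtain ⟨y, hy⟩ := hx.2.2.exists
      rw [hqi _ y hx hy, hadj x y hy.symm (hy ▸ hx)]
    · rw [hqe _ hx]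
      exact (htgt (s x) _ hx (hlast x hx)).symm
  have hni : ∀ x, (∀ e, z e ≠ x) → G.Internal (G.src x) := by
    intro x hx
    by_contra hc
    exact hx _ (hext x hc)
  refine ⟨q, s, z, hsz, hadj, ?_, ?_, ?_, ?_, ?_⟩
  · intro e
    by_cases he : G.Internal (G.src (z e))
    · rw [hqi _ (z e) he rfl, hsz, (hcyc e (hfi e _ (hfirst e) he)).1]
    · rw [hqe _ he]
      exact (hsrc e _ he (hfirst e)).symm
  · intro e
    rw [qt, hsz]
  · intro x hx
    rw [qt, hqi _ x (hni x hx) rfl]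
  · intro a
    rcases hV a with ⟨⟨c, hc⟩, rfl⟩ | ⟨e, -, he, -⟩
    · exact Or.inr ⟨c, hc, hqe c hc⟩
    · exact Or.inl ⟨e, he⟩
  · intro U hU
    have hD : ∀ x y, s x = s y → (G.tgt x ∈ U → G.tgt y ∈ U) := by
      intro x y hxy
      refine (hseg (s x)).1.propagate (fun v => G.tgt v ∈ U) ?_ x (hs x) y (hxy ▸ hs y)
      intro a b hb hab hi
      have hbm := List.mem_of_mem_tail hb
      have : ∀ e, z e ≠ b := by
        rintro e rfl
        have he : e = s x := (hsz e).symm.trans (hs' _ _ hbm)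
        subst he
        have hnd : (β (s x)).Nodup :=
          ((MGraph.isInternalPath_iff _).1 (hseg (s x)).1).2.2.2.1.of_map _
        rw [hzl] at hnd hb
        exact (List.nodup_cons.1 hnd).1 hb
      have h2 := hU b this
      rw [← hab] at h2
      exact h2
    have hR : ∀ u c, q u = ι c → (u ∈ U ↔ c.1 ∈ U) := by
      intro u c huc
      by_cases hu : G.Internal u
      · obtain ⟨x, rfl⟩ := hu.2.1.exists
        rw [qt] at huc
        rcases hdich (s x) with ⟨y, hy, h1, h2⟩ | ⟨h1, h2⟩
        · rw [h2] at huc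
          have := hι huc
          subst this
          exact ⟨hD x y hy.symm, hD y x hy⟩
        · exact (h2 ⟨c, by rw [h1, huc]⟩).elim
      · rw [hqe u hu] at huc
        have := hι huc
        subst this
        rfl
    intro u v huv huU
    by_cases hr : q u ∈ Set.range ι
    · obtain ⟨c, hc⟩ := hr
      exact (hR v c (huv ▸ hc.symm)).2 ((hR u c hc.symm).1 huU)
    · have hu : G.Internal u := by
        by_contra h
        exact hr ⟨⟨u, h⟩, (hqe u h).symm⟩
      have hv : G.Internal v := by
        by_contra h
        exact hr ⟨⟨v, h⟩, by rw [huv, hqe v h]⟩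
      obtain ⟨x, rfl⟩ := hu.2.1.exists
      obtain ⟨y, rfl⟩ := hv.2.1.exists
      refine hD x y ?_ huU
      rw [qt, qt] at huv
      rw [qt] at hr
      rcases hdich (s x) with ⟨y', -, h1, h2⟩ | ⟨h1, h2⟩
      · exact (hr ⟨_, h2.symm⟩).elim
      rcases hdich (s y) with ⟨y', -, h3, h4⟩ | ⟨h3, h4⟩
      · exact (hr ⟨_, by rw [huv, h4]⟩).elim
      exact heq _ _ (hfresh _ _ h2 h4 (by rw [h1, h3, huv]))

/-! ### Expansions and homomorphisms -/

/-- The database of a labelled CQ. -/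
def LCQ.toDB {A : Type} {n : ℕ} (P : LCQ A n) : DB A where
  V := P.V
  edge u a v := ∃ e, P.src e = u ∧ P.lab e = a ∧ P.tgt e = v

theorem LCQ.HomTo.trans {A : Type} {n : ℕ} {P Q R : LCQ A n} (h : P.HomTo Q)
    (h' : Q.HomTo R) : P.HomTo R := by
  obtain ⟨f, g, h1, h2, h3, h4⟩ := h
  obtain ⟨f', g', h1', h2', h3', h4'⟩ := h'
  refine ⟨f' ∘ f, g' ∘ g, ?_, ?_, ?_, ?_⟩
  · intro e; simp [h1', h1]
  · intro e; simp [h2', h2]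
  · intro e; simp [h3', h3]
  · intro e; simp [h4', h4]

/-- The `k`-th vertex of path `i` in the expansion. -/
def expNode {A : Type} {n : ℕ} (γ : CRPQ A n) (w : γ.I → List A) (i : γ.I) (k : ℕ) :
    Quot (canonRel γ w) := Quot.mk _ (nodeAt γ w i k)

/-- The class of an original variable. -/
def expVar {A : Type} {n : ℕ} (γ : CRPQ A n) (w : γ.I → List A) (v : γ.V) :
    Quot (canonRel γ w) := Quot.mk _ (Sum.inl v)

theorem expNode_zero {A : Type} {n : ℕ} (γ : CRPQ A n) (w : γ.I → List A) (i : γ.I) :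
    expNode γ w i 0 = expVar γ w (γ.src i) := by
  simp [expNode, expVar, nodeAt]

theorem expVar_eq_of_nil {A : Type} {n : ℕ} (γ : CRPQ A n) (w : γ.I → List A) (i : γ.I)
    (h : w i = []) : expVar γ w (γ.src i) = expVar γ w (γ.tgt i) :=
  Quot.sound ⟨i, h, rfl, rfl⟩

theorem expNode_length {A : Type} {n : ℕ} (γ : CRPQ A n) (w : γ.I → List A) (i : γ.I) :
    expNode γ w i (w i).length = expVar γ w (γ.tgt i) := by
  by_cases h : w i = []
  · rw [← expVar_eq_of_nil γ w i h, ← expNode_zero, h]; rfl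
  · have : (w i).length ≠ 0 := by simpa using h
    simp [expNode, expVar, nodeAt, h]

theorem nodeAt_inner {A : Type} {n : ℕ} (γ : CRPQ A n) (w : γ.I → List A) (i : γ.I) (k : ℕ)
    (h : 0 < k ∧ k < (w i).length) :
    nodeAt γ w i k = Sum.inr ⟨i, ⟨k - 1, by omega⟩⟩ := by
  unfold nodeAt
  exact dif_pos h

/-- Definition of functions on expansions. -/
theorem exists_expLift {A : Type} {n : ℕ} (γ : CRPQ A n) (w : γ.I → List A) {X : Type}
    (f : γ.V → X) (g : γ.I → ℕ → X) (h : ∀ i, w i = [] → f (γ.src i) = f (γ.tgt i)) :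
    ∃ F : Quot (canonRel γ w) → X, (∀ v, F (expVar γ w v) = f v) ∧
      ∀ i k, 0 < k → k < (w i).length → F (expNode γ w i k) = g i k := by
  refine ⟨Quot.lift (Sum.elim f (fun p => g p.1 (p.2.1 + 1))) ?_, fun _ => rfl, ?_⟩
  · rintro a b ⟨i, hi, rfl, rfl⟩
    exact h i hi
  · intro i k h0 hk
    unfold expNode
    rw [nodeAt_inner γ w i k ⟨h0, hk⟩]
    change g i (k - 1 + 1) = _
    rw [Nat.sub_add_cancel h0]

theorem expNode_cases {A : Type} {n : ℕ} (γ : CRPQ A n) (w : γ.I → List A) (i : γ.I) (k : ℕ)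
    (hk : k ≤ (w i).length) :
    (0 < k ∧ k < (w i).length) ∨ ∃ v, expNode γ w i k = expVar γ w v := by
  by_cases h0 : k = 0
  · subst h0
    exact Or.inr ⟨_, expNode_zero γ w i⟩
  · by_cases hl : k = (w i).length
    · subst hl
      exact Or.inr ⟨_, expNode_length γ w i⟩
    · left; omega

theorem expNode_inj {A : Type} {n : ℕ} (γ : CRPQ A n) (w : γ.I → List A) {i i' : γ.I}
    {k k' : ℕ} (h0 : 0 < k) (hk : k < (w i).length) (hk' : k' ≤ (w i').length)
    (h : expNode γ w i' k' = expNode γ w i k) : i' = i ∧ k' = k := by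
  obtain ⟨F, hF1, hF2⟩ := exists_expLift γ w (X := Option (γ.I × ℕ)) (fun _ => none)
    (fun i k => some (i, k)) (fun _ _ => rfl)
  have h' := congrArg F h
  rw [hF2 i k h0 hk] at h'
  rcases expNode_cases γ w i' k' hk' with ⟨h1, h2⟩ | ⟨v, hv⟩
  · rw [hF2 i' k' h1 h2] at h'
    simpa using h'
  · rw [hv, hF1] at h'
    cases h'

theorem expVar_ne_node {A : Type} {n : ℕ} (γ : CRPQ A n) (w : γ.I → List A) {i : γ.I}
    {k : ℕ} (h0 : 0 < k) (hk : k < (w i).length) (v : γ.V) :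
    expVar γ w v ≠ expNode γ w i k := by
  intro h
  obtain ⟨F, hF1, hF2⟩ := exists_expLift γ w (X := Bool) (fun _ => false)
    (fun i k => true) (fun _ _ => rfl)
  have h' := congrArg F h
  rw [hF2 i k h0 hk, hF1] at h'
  cases h'

theorem exp_cases {A : Type} {n : ℕ} (γ : CRPQ A n) (w : γ.I → List A)
    (q : Quot (canonRel γ w)) :
    (∃ v, q = expVar γ w v) ∨ ∃ i k, 0 < k ∧ k < (w i).length ∧ q = expNode γ w i k := by
  induction q using Quot.ind with | _ b =>
  rcases b with v | ⟨i, k⟩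
  · exact Or.inl ⟨v, rfl⟩
  · right
    have hk := k.2
    refine ⟨i, k.1 + 1, by omega, by omega, ?_⟩
    unfold expNode
    exact congrArg (Quot.mk _) (nodeAt_inner γ w i (k.1 + 1) ⟨by omega, by omega⟩).symm

theorem DB.path_iff_exists {A : Type} (G : DB A) : ∀ (w : List A) (u v : G.V),
    G.path w u v ↔ ∃ p : ℕ → G.V, p 0 = u ∧ p w.length = v ∧
      ∀ (k : ℕ) (hk : k < w.length), G.edge (p k) w[k] (p (k + 1))
  | [], u, v => by
    constructor
    · intro h
      exact ⟨fun _ => u, rfl, h, fun k hk => absurd hk (by simp)⟩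
    · rintro ⟨p, rfl, rfl, -⟩
      rfl
  | a :: w, u, v => by
    constructor
    · rintro ⟨x, h1, h2⟩
      obtain ⟨p, rfl, rfl, h3⟩ := (DB.path_iff_exists G w x v).1 h2
      refine ⟨fun k => Nat.casesOn k u p, rfl, rfl, ?_⟩
      intro k hk
      cases k with
      | zero => exact h1
      | succ k => exact h3 k (by simpa using hk)
    · rintro ⟨p, rfl, rfl, h3⟩
      refine ⟨p 1, h3 0 (by simp), (DB.path_iff_exists G w _ _).2 ⟨fun k => p (k + 1), rfl, rfl, ?_⟩⟩
      intro k hk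
      exact h3 (k + 1) (by simpa using hk)

theorem sat_self {A : Type} {n : ℕ} (γ : CRPQ A n) (w : γ.I → List A)
    (hw : γ.IsExpansionWords w) : γ.sat (expLCQ γ w).toDB (expLCQ γ w).out := by
  refine ⟨expVar γ w, fun _ => rfl, fun i => ⟨w i, hw i, ?_⟩⟩
  refine (DB.path_iff_exists _ _ _ _).2 ?_
  refine ⟨expNode γ w i, expNode_zero γ w i, expNode_length γ w i, ?_⟩
  intro k hk
  exact ⟨⟨i, k, hk⟩, rfl, rfl, rfl⟩

theorem hom_of_sat {A : Type} {n : ℕ} (γ : CRPQ A n) (P : LCQ A n)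
    (h : γ.sat P.toDB P.out) :
    ∃ w, γ.IsExpansionWords w ∧ (expLCQ γ w).HomTo P := by
  obtain ⟨h, ho, hp⟩ := h
  choose w hw hp using hp
  simp only [DB.path_iff_exists] at hp
  choose p hp0 hpl hpe using hp
  choose g hg using hpe
  obtain ⟨f, hf1, hf2⟩ := exists_expLift γ w (X := P.V) h p (by
    intro i hi
    have h1 := hp0 i
    have h2 := hpl i
    simp only [hi, List.length_nil] at h2
    exact h1.symm.trans h2)
  have hf : ∀ i k, k ≤ (w i).length → f (expNode γ w i k) = p i k := by
    intro i k hk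
    by_cases h0 : k = 0
    · subst h0
      rw [expNode_zero, hf1]
      exact (hp0 i).symm
    · by_cases hl : k = (w i).length
      · subst hl
        rw [expNode_length, hf1]
        exact (hpl i).symm
      · exact hf2 i k (by omega) (by omega)
  refine ⟨w, hw, f, fun e => g e.1 e.2.1 e.2.2, ?_, ?_, ?_, ?_⟩
  · rintro ⟨i, k, hk⟩
    exact (hg i k hk).1.trans (hf i k hk.le).symm
  · rintro ⟨i, k, hk⟩
    exact (hg i k hk).2.2.trans (hf i (k + 1) hk).symm
  · rintro ⟨i, k, hk⟩
    exact (hg i k hk).2.1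
  · intro k
    exact (hf1 _).trans (ho k)

/-! ### Transfer of the model from the core to the query -/

theorem embed {A : Type} {n : ℕ} (δ : CRPQ A n) (w : δ.I → List A) (C : LCQ A n)
    (hcore : ∀ fV fE, LCQHom C C fV fE → Function.Bijective fV ∧ Function.Bijective fE)
    (hCD : C.HomTo (expLCQ δ w)) (hDC : (expLCQ δ w).HomTo C) :
    ∃ (fV : C.V → Quot (canonRel δ w)) (I : C.E → δ.I) (K : C.E → ℕ),
      Function.Injective fV ∧
      (∀ x, K x < (w (I x)).length) ∧
      (∀ x y, I x = I y → K x = K y → x = y) ∧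
      (∀ x, fV (C.src x) = expNode δ w (I x) (K x)) ∧
      (∀ x, fV (C.tgt x) = expNode δ w (I x) (K x + 1)) ∧
      (∀ k, fV (C.out k) = expVar δ w (δ.out k)) ∧
      (∀ c i k, k < (w i).length → fV c = expNode δ w i k → ∃ x, C.src x = c) ∧
      (∀ c i k, k < (w i).length → fV c = expNode δ w i (k + 1) → ∃ x, C.tgt x = c) := by
  obtain ⟨fV, fE, f1, f2, f3, f4⟩ := hCD
  obtain ⟨gV, gE, g1, g2, g3, g4⟩ := hDC
  obtain ⟨bV, bE⟩ := hcore (gV ∘ fV) (gE ∘ fE)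
    ⟨fun e => by simp [g1, f1], fun e => by simp [g2, f2], fun e => by simp [g3, f3],
      fun e => by simp [g4, f4]⟩
  have iV : Function.Injective fV := bV.1.of_comp
  have iE : Function.Injective fE := bE.1.of_comp
  refine ⟨fV, fun x => (fE x).1, fun x => (fE x).2.1, iV, fun x => (fE x).2.2, ?_,
    fun x => (f1 x).symm, fun x => (f2 x).symm, f4, ?_, ?_⟩
  · intro x y h h'
    apply iE
    have gen : ∀ a b : (Σ i : δ.I, Fin ((w i).length)), a.1 = b.1 → a.2.1 = b.2.1 → a = b := by
      rintro ⟨i, k⟩ ⟨i', k'⟩ h h'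
      dsimp only at h
      subst h
      have h2 : k = k' := Fin.ext h'
      rw [h2]
    exact gen _ _ h h'
  · intro c i k hk h
    obtain ⟨e, he⟩ : ∃ e : (expLCQ δ w).E, (expLCQ δ w).src e = expNode δ w i k :=
      ⟨⟨i, k, hk⟩, rfl⟩
    obtain ⟨x, hx⟩ := bE.2 (gE e)
    refine ⟨x, bV.1 ?_⟩
    simp only [Function.comp] at hx ⊢
    rw [← f1, ← g1, hx, g1, he, h]
  · intro c i k hk h
    obtain ⟨e, he⟩ : ∃ e : (expLCQ δ w).E, (expLCQ δ w).tgt e = expNode δ w i (k + 1) :=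
      ⟨⟨i, k, hk⟩, rfl⟩
    obtain ⟨x, hx⟩ := bE.2 (gE e)
    refine ⟨x, bV.1 ?_⟩
    simp only [Function.comp] at hx ⊢
    rw [← f2, ← g2, hx, g2, he, h]

theorem transfer {A : Type} {n : ℕ} (δ : CRPQ A n) (w : δ.I → List A) (C : MGraph)
    (finE : Finite C.E)
    (fV : C.V → Quot (canonRel δ w)) (I : C.E → δ.I) (K : C.E → ℕ)
    (iV : Function.Injective fV)
    (hK : ∀ x, K x < (w (I x)).length)
    (eqE : ∀ x y, I x = I y → K x = K y → x = y)
    (f1' : ∀ x, fV (C.src x) = expNode δ w (I x) (K x))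
    (f2' : ∀ x, fV (C.tgt x) = expNode δ w (I x) (K x + 1))
    (f4 : ∀ c ∈ C.out, ∃ v, fV c = expVar δ w v)
    (liftS : ∀ c i k, k < (w i).length → fV c = expNode δ w i k → ∃ x, C.src x = c)
    (liftT : ∀ c i k, k < (w i).length → fV c = expNode δ w i (k + 1) → ∃ x, C.tgt x = c)
    (H : MGraph) (hH : IsSegmentGraph C H) : MinorModel δ.toMGraph H := by
  classical
  have posS : ∀ x i k, 0 < k → k < (w i).length → fV (C.src x) = expNode δ w i k →
      I x = i ∧ K x = k := by
    intro x i k h0 hk h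
    exact expNode_inj δ w h0 hk (hK x).le ((f1' x).symm.trans h)
  have posT : ∀ x i k, 0 < k → k < (w i).length → fV (C.tgt x) = expNode δ w i k →
      I x = i ∧ K x + 1 = k := by
    intro x i k h0 hk h
    exact expNode_inj δ w h0 hk (hK x) ((f2' x).symm.trans h)
  -- inner vertices are internal in the core
  have hIntl : ∀ c i k, 0 < k → k < (w i).length → fV c = expNode δ w i k →
      C.Internal c := by
    intro c i k h0 hk h
    refine ⟨?_, ?_, ?_⟩
    · intro ho
      obtain ⟨v, hv⟩ := f4 c ho
      exact expVar_ne_node δ w h0 hk v (hv.symm.trans h)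
    · obtain ⟨x, hx⟩ := liftT c i (k - 1) (by omega) (by
        rw [h, Nat.sub_add_cancel h0])
      refine ⟨x, hx, ?_⟩
      intro y hy
      have p1 := posT x i k h0 hk (by rw [hx, h])
      have p2 := posT y i k h0 hk (by rw [hy, h])
      exact eqE _ _ (p2.1.trans p1.1.symm) (by omega)
    · obtain ⟨x, hx⟩ := liftS c i k hk h
      refine ⟨x, hx, ?_⟩
      intro y hy
      have p1 := posS x i k h0 hk (by rw [hx, h])
      have p2 := posS y i k h0 hk (by rw [hy, h])
      exact eqE _ _ (p2.1.trans p1.1.symm) (by omega)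
  -- whole paths are in the core
  have up : ∀ x, ∀ d, (K x) + d < (w (I x)).length →
      ∃ y, (I y) = (I x) ∧ (K y) = (K x) + d := by
    intro x d
    induction d with
    | zero => intro _; exact ⟨x, rfl, rfl⟩
    | succ d ih =>
      intro hd
      obtain ⟨y, hy1, hy2⟩ := ih (by omega)
      have ht : fV (C.tgt y) = expNode δ w (I x) ((K x) + (d + 1)) := by
        rw [f2', hy1, hy2]; rfl
      obtain ⟨v, hv⟩ := liftS (C.tgt y) (I x) ((K x) + (d + 1)) hd ht
      obtain ⟨p1, p2⟩ := posS v _ _ (by omega) hd (by rw [hv, ht])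
      exact ⟨v, p1, p2⟩
  have down : ∀ x, ∀ d, d ≤ (K x) →
      ∃ y, (I y) = (I x) ∧ (K y) = (K x) - d := by
    intro x d
    have hlt := hK x
    induction d with
    | zero => intro _; exact ⟨x, rfl, rfl⟩
    | succ d ih =>
      intro hd
      obtain ⟨y, hy1, hy2⟩ := ih (by omega)
      have ht : fV (C.src y) = expNode δ w (I x) ((K x) - (d + 1) + 1) := by
        rw [f1', hy1, hy2]; congr 1; omega
      obtain ⟨v, hv⟩ := liftT (C.src y) (I x) ((K x) - (d + 1)) (by omega) ht
      obtain ⟨p1, p2⟩ := posT v (I x) (K x - (d + 1) + 1) (by omega) (by omega) (by rw [hv, ht])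
      exact ⟨v, p1, by omega⟩
  have whole : ∀ x, ∀ k, k < (w (I x)).length →
      ∃ y, (I y) = (I x) ∧ (K y) = k := by
    intro x k hk
    by_cases h : (K x) ≤ k
    · obtain ⟨y, h1, h2⟩ := up x (k - (K x)) (by omega)
      exact ⟨y, h1, by omega⟩
    · obtain ⟨y, h1, h2⟩ := down x ((K x) - k) (by omega)
      exact ⟨y, h1, by omega⟩
  obtain ⟨q, s, z, hsz, hadj, hqs, hqt, hqx, hqa, hU⟩ := hH.model finE
  -- the segment is constant on paths
  have hsc : ∀ (m : ℕ) x y, (I x) = (I y) → (K y) = (K x) + m → s x = s y := by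
    intro m
    induction m with
    | zero => intro x y h1 h2; rw [eqE x y h1 (by omega)]
    | succ m ih =>
      intro x y h1 h2
      have hylt : (K y) < (w (I x)).length := by
        rw [h1]; exact hK y
      obtain ⟨v, hv1, hv2⟩ := whole x ((K x) + m) (by omega)
      rw [ih x v hv1.symm hv2]
      have e1 : fV (C.tgt v) = expNode δ w (I x) (K y) := by
        rw [f2', hv1, hv2, h2]; rfl
      have e2 : fV (C.src y) = expNode δ w (I x) (K y) := by
        rw [f1', h1]
      exact hadj v y (iV (e1.trans e2.symm)) (hIntl _ _ _ (by omega) hylt e2)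
  have hsc' : ∀ x y, (I x) = (I y) → s x = s y := by
    intro x y h
    rcases le_total (K x) (K y) with h' | h'
    · exact hsc _ x y h (Nat.add_sub_of_le h').symm
    · exact (hsc _ y x h.symm (Nat.add_sub_of_le h').symm).symm
  have hjinj : ∀ e e', (I (z e)) = (I (z e')) → e = e' := by
    intro e e' h
    have := hsc' _ _ h
    rwa [hsz, hsz] at this
  -- nodes of paths in the core
  have nodeC : ∀ x, ∀ k, k ≤ (w (I x)).length → ∃ c, fV c = expNode δ w (I x) k := by
    intro x k hk
    have hlt := hK x
    rcases Nat.lt_or_ge k (w (I x)).length with h | h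
    · obtain ⟨y, h1, h2⟩ := whole x k h
      exact ⟨C.src y, by rw [f1', h1, h2]⟩
    · obtain ⟨y, h1, h2⟩ := whole x (k - 1) (by omega)
      exact ⟨C.tgt y, by rw [f2', h1, h2, Nat.sub_add_cancel (by omega)]⟩
  -- `q` is constant between non-kept edges
  have qstep : ∀ x k c c', k < (w (I x)).length → fV c = expNode δ w (I x) k →
      fV c' = expNode δ w (I x) (k + 1) →
      (∀ e, (I (z e)) = (I x) → (K (z e)) ≠ k) → q c = q c' := by
    intro x k c c' hk hc hc' hne
    obtain ⟨y, h1, h2⟩ := whole x k hk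
    have e1 : C.src y = c := iV (by rw [f1', h1, h2, hc])
    have e2 : C.tgt y = c' := iV (by rw [f2', h1, h2, hc'])
    rw [← e1, ← e2]
    apply hqx y
    rintro e rfl
    exact hne e h1 h2
  have qrange : ∀ x (m k : ℕ) c c', k + m ≤ (w (I x)).length →
      fV c = expNode δ w (I x) k → fV c' = expNode δ w (I x) (k + m) →
      (∀ e, (I (z e)) = (I x) → ¬ (k ≤ (K (z e)) ∧ (K (z e)) < k + m)) →
      q c = q c' := by
    intro x m
    induction m with
    | zero =>
      intro k c c' _ hc hc' _
      rw [iV (hc.trans hc'.symm)]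
    | succ m ih =>
      intro k c c' hk hc hc' hne
      obtain ⟨c₁, hc₁⟩ := nodeC x (k + m) (by omega)
      rw [ih k c c₁ (by omega) hc hc₁ (fun e he h => hne e he ⟨h.1, by omega⟩)]
      refine qstep x (k + m) c₁ c' (by omega) hc₁ hc' ?_
      intro e he h
      exact hne e he ⟨by omega, by omega⟩
  -- endpoints
  have nsrc : ∀ x, ∃ c, fV c = expVar δ w (δ.src (I x)) := by
    intro x
    obtain ⟨c, hc⟩ := nodeC x 0 (Nat.zero_le _)
    exact ⟨c, by rw [hc, expNode_zero]⟩
  have ntgt : ∀ x, ∃ c, fV c = expVar δ w (δ.tgt (I x)) := by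
    intro x
    obtain ⟨c, hc⟩ := nodeC x _ le_rfl
    exact ⟨c, by rw [hc, expNode_length]⟩
  -- the model map
  have hp : ∀ v, ∃ o : Option H.V, (∀ c, fV c = expVar δ w v → o = some (q c)) ∧
      (∀ a, o = some a → ∃ c, fV c = expVar δ w v ∧ q c = a) := by
    intro v
    by_cases h : ∃ c, fV c = expVar δ w v
    · obtain ⟨c, hc⟩ := h
      refine ⟨some (q c), ?_, ?_⟩
      · intro c' hc'
        rw [iV (hc.trans hc'.symm)]
      · intro a ha
        exact ⟨c, hc, Option.some.inj ha⟩
    · refine ⟨none, fun c hc => (h ⟨c, hc⟩).elim, fun a ha => by cases ha⟩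
  choose p hp1 hp2 using hp
  have hpe : ∀ u v, expVar δ w u = expVar δ w v → p u = p v := by
    intro u v h
    cases hu : p u with
    | some a =>
      obtain ⟨c, hc, rfl⟩ := hp2 u a hu
      exact (hp1 v c (hc.trans h)).symm
    | none =>
      cases hv : p v with
      | none => rfl
      | some a =>
        obtain ⟨c, hc, rfl⟩ := hp2 v a hv
        rw [hp1 u c (hc.trans h.symm)] at hu
        cases hu
  have psrc : ∀ e, p (δ.src (I (z e))) = some (H.src e) := by
    intro e
    have hlt := hK (z e)
    obtain ⟨c, hc⟩ := nsrc (z e)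
    rw [hp1 _ c hc, ← hqs e]
    congr 1
    refine qrange (z e) (K (z e)) 0 c _ (by omega) ?_ ?_ ?_
    · rw [hc, expNode_zero]
    · rw [Nat.zero_add]; exact f1' (z e)
    · intro e' he'
      rw [hjinj _ _ he']; omega
  have ptgt : ∀ e, p (δ.tgt (I (z e))) = some (H.tgt e) := by
    intro e
    have hlt := hK (z e)
    obtain ⟨c, hc⟩ := ntgt (z e)
    rw [hp1 _ c hc, ← hqt e]
    congr 1
    symm
    refine qrange (z e) ((w (I (z e))).length - ((K (z e)) + 1)) ((K (z e)) + 1)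
      _ c (by omega) ?_ ?_ ?_
    · exact f2' (z e)
    · rw [hc, Nat.add_sub_of_le (by omega), expNode_length]
    · intro e' he'
      rw [hjinj _ _ he']; omega
  refine ⟨p, {i | w i = [] ∨ ((∃ x, (I x) = i) ∧ ∀ e, (I (z e)) ≠ i)},
    fun e => (I (z e)), hjinj, ?_, psrc, ptgt, ?_, ?_, ?_⟩
  · intro a
    rcases hqa a with ⟨e, rfl⟩ | ⟨c, hc, rfl⟩
    · exact ⟨_, ptgt e⟩
    · rcases exp_cases δ w (fV c) with ⟨v, hv⟩ | ⟨i, k, h0, hk, h⟩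
      · exact ⟨v, hp1 v c hv⟩
      · exact (hc (hIntl c i k h0 hk h)).elim
  · rintro e (h | ⟨-, h⟩)
    · have hlt := hK (z e)
      rw [h] at hlt
      simp at hlt
    · exact h e rfl
  · rintro i (h | ⟨⟨x, rfl⟩, h⟩)
    · exact hpe _ _ (expVar_eq_of_nil δ w i h)
    · obtain ⟨c, hc⟩ := nsrc x
      obtain ⟨c', hc'⟩ := ntgt x
      change p (δ.src _) = p (δ.tgt _)
      rw [hp1 _ c hc, hp1 _ c' hc']
      congr 1
      refine qrange x (w (I x)).length 0 c c' (by omega) ?_ ?_ ?_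
      · rw [hc, expNode_zero]
      · rw [hc', Nat.zero_add, expNode_length]
      · intro e he
        exact (h e he).elim
  · intro U hT u v a hu hv huU
    obtain ⟨c, hc, rfl⟩ := hp2 u a hu
    obtain ⟨c', hc', hcc⟩ := hp2 v _ hv
    -- cut points
    have hκ : ∀ i, ∃ k, (∀ e, (I (z e)) = i → (K (z e)) = k) ∧
        ((∀ e, I (z e) ≠ i) → k = 0) := by
      intro i
      by_cases h : ∃ e, (I (z e)) = i
      · obtain ⟨e, rfl⟩ := h
        refine ⟨(K (z e)), fun e' he' => ?_, fun h => (h e rfl).elim⟩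
        rw [hjinj _ _ he']
      · exact ⟨0, fun e he => (h ⟨e, he⟩).elim, fun _ => rfl⟩
    choose κ hκ hκ0 using hκ
    have hκlt : ∀ x, κ (I x) < (w (I x)).length := by
      intro x
      by_cases h : ∃ e, I (z e) = I x
      · obtain ⟨e, he⟩ := h
        rw [← hκ _ e he, ← he]
        exact hK (z e)
      · rw [hκ0 _ (fun e he => h ⟨e, he⟩)]
        have := hK x
        omega
    obtain ⟨W, hW0, hW1⟩ := exists_expLift δ w (X := Prop) (fun v => v ∈ U)
      (fun i k => if k ≤ κ i then δ.src i ∈ U else δ.tgt i ∈ U)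
      (fun i hi => propext (hT i (Or.inl hi)))
    have hW : ∀ i k, κ i < (w i).length → k ≤ (w i).length →
        W (expNode δ w i k) = if k ≤ κ i then δ.src i ∈ U else δ.tgt i ∈ U := by
      intro i k hki hk
      by_cases h0 : k = 0
      · subst h0
        rw [expNode_zero, if_pos (Nat.zero_le _), hW0]
      · by_cases hl : k = (w i).length
        · subst hl
          rw [expNode_length, if_neg (by omega), hW0]
        · exact hW1 i k (by omega) (by omega)
    have huW : W (fV c) := by
      rw [hc]
      exact (hW0 u).symm ▸ huU
    have key := hU {c | W (fV c)} ?_ c c' hcc.symm huW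
    · change W (fV c') at key
      rw [hc'] at key
      exact (hW0 v) ▸ key
    · intro x hx
      change W (fV (C.src x)) ↔ W (fV (C.tgt x))
      have hlt := hK x
      rw [f1', f2', hW _ _ (hκlt x) hlt.le, hW _ _ (hκlt x) hlt]
      by_cases h : ∃ e, I (z e) = I x
      · obtain ⟨e, he⟩ := h
        have h1 := hκ _ e he
        have hne : K x ≠ κ (I x) := by
          intro h2
          exact hx e (eqE _ _ he (h1.trans h2.symm))
        by_cases h3 : K x ≤ κ (I x)
        · rw [if_pos h3, if_pos (by omega)]
        · rw [if_neg h3, if_neg (by omega)]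
      · have hT' := hT (I x) (Or.inr ⟨⟨x, rfl⟩, fun e he => h ⟨e, he⟩⟩)
        change δ.src (I x) ∈ U ↔ δ.tgt (I x) ∈ U at hT'
        split_ifs
        · rfl
        · exact hT'
        · exact hT'.symm
        · rfl

/-- Semantical Structure theorem: if `ξ = expLCQ γ w` is a hom-minimal expansion of the
UCRPQ `Γ` and `Δ` is any UCRPQ equivalent to `Γ`, then the segment graph of any core of
`ξ` is a minor of the underlying graph of some disjunct of `Δ`; in particular the number
of segments of the core is at most the maximum number of atoms of a disjunct of `Δ`. -/
theorem semantical_structure {A : Type} {n : ℕ} (Γ Δ : List (CRPQ A n))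
    (hequiv : ∀ (G : DB A) (t : Fin n → G.V),
      (∃ γ ∈ Γ, γ.sat G t) ↔ (∃ δ ∈ Δ, δ.sat G t))
    (γ : CRPQ A n) (hγ : γ ∈ Γ) (w : γ.I → List A) (hw : γ.IsExpansionWords w)
    (hmin : ∀ γ' ∈ Γ, ∀ w', γ'.IsExpansionWords w' →
      (expLCQ γ' w').HomTo (expLCQ γ w) → HomEquiv (expLCQ γ' w') (expLCQ γ w))
    (C : LCQ A n) (hC : IsCoreOf C (expLCQ γ w))
    (H : MGraph) (hH : IsSegmentGraph C.toMGraph H) :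
    (∃ δ ∈ Δ, IsMinorOf H δ.toMGraph) ∧ segCount C.toMGraph ≤ maxAtoms Δ := by
  obtain ⟨δ, hδ, hs⟩ := (hequiv (expLCQ γ w).toDB (expLCQ γ w).out).1
    ⟨γ, hγ, sat_self γ w hw⟩
  obtain ⟨w₁, hw₁, h₁⟩ := hom_of_sat δ (expLCQ γ w) hs
  obtain ⟨γ₂, hγ₂, hs₂⟩ := (hequiv (expLCQ δ w₁).toDB (expLCQ δ w₁).out).2
    ⟨δ, hδ, sat_self δ w₁ hw₁⟩
  obtain ⟨w₂, hw₂, h₂⟩ := hom_of_sat γ₂ (expLCQ δ w₁) hs₂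
  have h₃ := (hmin γ₂ hγ₂ w₂ hw₂ (h₂.trans h₁)).2
  have hCD : C.HomTo (expLCQ δ w₁) := hC.1.1.trans (h₃.trans h₂)
  have hDC : (expLCQ δ w₁).HomTo C := h₁.trans hC.1.2
  obtain ⟨fV, I, K, iV, hK, eqE, f1, f2, f4, liftS, liftT⟩ := embed δ w₁ C hC.2 hCD hDC
  have hm : IsMinorOf H δ.toMGraph :=
    (transfer δ w₁ C.toMGraph C.finE fV I K iV hK eqE f1 f2
      (by rintro c ⟨k, rfl⟩; exact ⟨_, f4 k⟩) liftS liftT H hH).isMinorOf δ.finV δ.finI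
  obtain ⟨hf, hle⟩ := hm.card_le δ.finI
  exact ⟨⟨δ, hδ, hm⟩, (segCount_le hH hf).trans (hle.trans (card_le_maxAtoms Δ δ hδ))⟩
end
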